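/- Let k ≥ 2 and suppose E[ξ^{k+2}] < ∞. Then there exists a constant C > 0 such that for all n ∈ I and all t ≥ 1: the probability under τ_n that sup over ℓ ≥ k of H*(root,ℓ) is at least t is at most C·t^{1−k}. -/

import Mathlib

/-! Finite ordered rooted (plane) trees: a tree is a finite list of its root subtrees. -/
inductive PTree : Type where
  | node : List PTree → PTree

namespace PTree

/-- the number of nodes of the tree -/
def size : PTree → ℕ
  | node ts => 1 + (ts.attach.map (fun x => size x.1)).sum
decreasing_by
  have := List.sizeOf_lt_of_mem x.2
  simp only [node.sizeOf_spec]; omega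

/-- the list of all subtrees rooted at the nodes of the tree -/
def subtrees : PTree → List PTree
  | node ts => node ts :: (ts.attach.map (fun x => subtrees x.1)).flatten
decreasing_by
  have := List.sizeOf_lt_of_mem x.2
  simp only [node.sizeOf_spec]; omega

/-- the height of the tree (maximal distance from the root to a node) -/
def height : PTree → ℕ
  | node ts => (ts.attach.map (fun x => height x.1 + 1)).foldr max 0
decreasing_by
  have := List.sizeOf_lt_of_mem x.2
  simp only [node.sizeOf_spec]; omega

/-- the number of children of the root (`ξ_ε`) -/
def rootDeg : PTree → ℕ
  | node ts => ts.length

/-- the sizes of the subtrees rooted at the children of the root -/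
def childSizes : PTree → List ℕ
  | node ts => ts.map size

/-- the sizes of the subtrees rooted at the children of the root,
sorted from largest to smallest -/
def sortedSizesDesc (T : PTree) : List ℕ :=
  T.childSizes.insertionSort (· ≥ ·)

/-- `N_k`: the `k`-th largest among the sizes of the subtrees rooted at the children
of the root (`0` if there are fewer than `k` children) -/
def Nk (k : ℕ) (T : PTree) : ℕ := (sortedSizesDesc T).getD (k - 1) 0

/-- `N_{k+} = N_k + N_{k+1} + ⋯` -/
def NkPlus (k : ℕ) (T : PTree) : ℕ := ((sortedSizesDesc T).drop (k - 1)).sum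

/-- the subtrees rooted at the nodes of the heavy path: starting at the root, always
continue to the first child of maximal subtree size -/
def heavyPath : PTree → List PTree
  | node ts =>
    node ts ::
      (match ts.attach.find? (fun x => x.1.size = ((ts.map size).foldr max 0)) with
       | some x => heavyPath x.1
       | none => [])
decreasing_by
  have := List.sizeOf_lt_of_mem x.2
  simp only [node.sizeOf_spec]; omega

end PTree

/-- `Z_k`: the number of nodes `v` of the tree whose subtree has size `k` -/
def Zk (k : ℕ) (T : PTree) : ℕ := (T.subtrees.filter (fun s => s.size = k)).length

/-- the rank (`1` = largest) of the `i`-th child (0-based) among siblings whose subtree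
sizes are given by the list `sizes`; ties are broken from left to right -/
def rankIn (sizes : List ℕ) (i : ℕ) : ℕ :=
  1 + ((List.range sizes.length).filter (fun j =>
        sizes.getD i 0 < sizes.getD j 0 ∨ (sizes.getD j 0 = sizes.getD i 0 ∧ j < i))).length

mutual
/-- the number of nodes of the `k`-heavy tree: the root together with all nodes `v` such
that `v` and every non-root ancestor of `v` has rank at most `k` among its siblings -/
def heavySize (k : ℕ) : PTree → ℕ
  | .node ts => 1 + heavySizeAux k (ts.map PTree.size) 0 ts
def heavySizeAux (k : ℕ) (sizes : List ℕ) : ℕ → List PTree → ℕ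
  | _, [] => 0
  | i, t :: rest =>
      (if rankIn sizes i ≤ k then heavySize k t else 0) + heavySizeAux k sizes (i + 1) rest
end

/-- `H*(v,ℓ)`: the height of the subtree rooted at the child of rank `ℓ` of the root of `v`
(`0` if there are fewer than `ℓ` children) -/
def Hstar : PTree → ℕ → ℕ
  | .node ts, ℓ =>
    match (List.range ts.length).find? (fun i => rankIn (ts.map PTree.size) i = ℓ) with
    | some i => (ts.getD i (.node [])).height
    | none => 0

/-- the weight of a tree: the product over all nodes `v` of `p (number of children of v)` -/
noncomputable def weight (p : ℕ → ℝ) : PTree → ℝ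
  | .node ts => p ts.length * (ts.attach.map (fun x => weight p x.1)).prod
decreasing_by
  have := List.sizeOf_lt_of_mem x.2
  simp only [PTree.node.sizeOf_spec]; omega

/-- the total weight of all trees of size `n` -/
noncomputable def treeSum (p : ℕ → ℝ) (n : ℕ) : ℝ :=
  ∑' T : {T : PTree // T.size = n}, weight p T.1

/-- the probability of the event `A` under the conditional Galton-Watson tree `τ_n` -/
noncomputable def condProb (p : ℕ → ℝ) (n : ℕ) (A : PTree → Prop) : ℝ :=
  (∑' T : {T : PTree // T.size = n ∧ A T}, weight p T.1) / treeSum p n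

/-- the expectation of `f` under the conditional Galton-Watson tree `τ_n` -/
noncomputable def condExp (p : ℕ → ℝ) (n : ℕ) (f : PTree → ℝ) : ℝ :=
  (∑' T : {T : PTree // T.size = n}, weight p T.1 * f T.1) / treeSum p n

/-- the variance of `f` under the conditional Galton-Watson tree `τ_n` -/
noncomputable def condVar (p : ℕ → ℝ) (n : ℕ) (f : PTree → ℝ) : ℝ :=
  condExp p n (fun T => f T ^ 2) - (condExp p n f) ^ 2

/-- the set `I = {n ≥ 1 : Σ_{|T| = n} w(T) > 0}` of sizes of positive probability -/
def gwSupport (p : ℕ → ℝ) : Set ℕ := {n | 1 ≤ n ∧ 0 < treeSum p n}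

/-- `P(S_m = x)` for the random walk `S_m = (ξ_1 - 1) + ⋯ + (ξ_m - 1)`, `ξ_i` i.i.d. `∼ p` -/
noncomputable def walkProb (p : ℕ → ℝ) (m : ℕ) (x : ℤ) : ℝ :=
  ∑' a : Fin m → ℕ, if (∑ i, ((a i : ℤ) - 1)) = x then ∏ i, p (a i) else 0

/-- `I_n = {1 ≤ k ≤ n : P(S_{n-k} = 0) > 0}` -/
def walkSupportIn (p : ℕ → ℝ) (n : ℕ) : Set ℕ :=
  {k | 1 ≤ k ∧ k ≤ n ∧ 0 < walkProb p (n - k) 0}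

/-- `h = gcd {i > 0 : p_i > 0}`, defined as the largest common divisor of the support -/
noncomputable def gcdSupp (p : ℕ → ℝ) : ℕ :=
  sSup {d : ℕ | 0 < d ∧ ∀ i : ℕ, 0 < i → 0 < p i → d ∣ i}

/-- `α = h / (σ √(2π))` where `σ² = Σ i² p_i - 1` -/
noncomputable def gwAlpha (p : ℕ → ℝ) : ℝ :=
  (gcdSupp p : ℝ) /
    (Real.sqrt ((∑' i : ℕ, (i : ℝ) ^ 2 * p i) - 1) * Real.sqrt (2 * Real.pi))

/-- the moment `E[ξ^m] = Σ i^m p_i` is finite -/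
def MomentFinite (p : ℕ → ℝ) (m : ℝ) : Prop :=
  Summable (fun i : ℕ => (i : ℝ) ^ m * p i)

open scoped ENNReal

namespace PTree

theorem size_node (ts : List PTree) : size (node ts) = 1 + (ts.map size).sum := by
  rw [size, List.attach_map_val (f := size)]

theorem size_node_ofFn {d : ℕ} (f : Fin d → PTree) :
    size (node (List.ofFn f)) = 1 + ∑ i, size (f i) := by
  rw [size_node, List.map_ofFn, List.sum_ofFn]; rfl

theorem size_pos (T : PTree) : 0 < size T := by
  cases T; rw [size_node]; omega

theorem lt_height_node_iff (h : ℕ) (ts : List PTree) :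
    h + 1 ≤ height (node ts) ↔ ∃ T ∈ ts, h ≤ height T := by
  rw [height, List.attach_map_val (f := fun T => height T + 1)]
  induction ts with
  | nil => simp
  | cons a l ih => simp [ih]

theorem lt_height_node_ofFn_iff (h : ℕ) {d : ℕ} (f : Fin d → PTree) :
    h + 1 ≤ height (node (List.ofFn f)) ↔ ∃ i, h ≤ height (f i) := by
  rw [lt_height_node_iff]
  simp

/-- Trees are finite sequences of trees. -/
def tupleEquiv : (Σ d, Fin d → PTree) ≃ PTree :=
  List.equivSigmaTuple.symm.trans
    { toFun := node
      invFun := fun T => match T with | node ts => ts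
      left_inv := fun _ => rfl
      right_inv := fun T => by cases T; rfl }

theorem tsum_eq_tsum_tuple (F : PTree → ℝ≥0∞) :
    ∑' T, F T = ∑' d, ∑' f : Fin d → PTree, F (node (List.ofFn f)) := by
  rw [← tupleEquiv.tsum_eq F, ENNReal.tsum_sigma']
  rfl

end PTree

theorem weight_node (p : ℕ → ℝ) (ts : List PTree) :
    weight p (.node ts) = p ts.length * (ts.map (weight p)).prod := by
  rw [weight, List.attach_map_val (f := weight p)]

theorem weight_node_ofFn (p : ℕ → ℝ) {d : ℕ} (f : Fin d → PTree) :
    weight p (.node (List.ofFn f)) = p d * ∏ i, weight p (f i) := by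
  rw [weight_node, List.map_ofFn, List.prod_ofFn, List.length_ofFn]; rfl

theorem weight_nonneg {p : ℕ → ℝ} (hp : ∀ i, 0 ≤ p i) : ∀ T : PTree, 0 ≤ weight p T
  | .node ts => by
    rw [weight_node]
    refine mul_nonneg (hp _) (List.prod_nonneg fun x hx => ?_)
    obtain ⟨T, hT, rfl⟩ := List.mem_map.1 hx
    have := List.sizeOf_lt_of_mem hT
    exact weight_nonneg hp T
termination_by T => sizeOf T
decreasing_by simp only [PTree.node.sizeOf_spec]; omega

/-- The weight of a tree as an extended nonnegative real. -/
noncomputable def eweight (p : ℕ → ℝ) (T : PTree) : ℝ≥0∞ := ENNReal.ofReal (weight p T)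

theorem eweight_node_ofFn {p : ℕ → ℝ} (hp : ∀ i, 0 ≤ p i) {d : ℕ} (f : Fin d → PTree) :
    eweight p (.node (List.ofFn f)) = ENNReal.ofReal (p d) * ∏ i, eweight p (f i) := by
  rw [eweight, weight_node_ofFn, ENNReal.ofReal_mul (hp d),
    ENNReal.ofReal_prod_of_nonneg fun i _ => weight_nonneg hp (f i)]
  rfl

section PiSums
variable {ι β : Type*}

theorem ENNReal.tsum_pi_eq_tsum_funSplitAt [DecidableEq ι] (i : ι) (F : (ι → β) → ℝ≥0∞) :
    ∑' f, F f = ∑' x, ∑' g, F ((Equiv.funSplitAt i β).symm (x, g)) := by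
  rw [← (Equiv.funSplitAt i β).symm.tsum_eq F, ENNReal.tsum_prod']

theorem ENNReal.tsum_fin_cons {d : ℕ} (F : (Fin (d + 1) → β) → ℝ≥0∞) :
    ∑' f, F f = ∑' x, ∑' g : Fin d → β, F (Fin.cons x g) := by
  rw [← (Fin.consEquiv fun _ => β).tsum_eq F, ENNReal.tsum_prod']
  rfl

theorem ENNReal.tsum_pi_prod [Fintype ι] (a : ι → β → ℝ≥0∞) :
    ∑' f : ι → β, ∏ i, a i (f i) = ∏ i, ∑' x, a i x := by
  have key : ∀ (d : ℕ) (a : Fin d → β → ℝ≥0∞),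
      ∑' f : Fin d → β, ∏ i, a i (f i) = ∏ i, ∑' x, a i x := by
    intro d
    induction d with
    | zero => intro a; simp
    | succ d ih =>
      intro a
      rw [ENNReal.tsum_fin_cons]
      simp only [Fin.prod_univ_succ, Fin.cons_zero, Fin.cons_succ]
      simp_rw [ENNReal.tsum_mul_left, ih, ENNReal.tsum_mul_right]
  let e := Fintype.equivFin ι
  rw [← (Equiv.arrowCongr e.symm (Equiv.refl β)).tsum_eq, ← e.symm.prod_comp,
    ← key _ fun i => a (e.symm i)]
  refine tsum_congr fun f => ?_
  rw [← e.symm.prod_comp]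
  simp

theorem prod_funSplitAt [Fintype ι] [DecidableEq ι] (w : β → ℝ≥0∞) (i : ι) (x : β) (g : {j // j ≠ i} → β) :
    ∏ j, w ((Equiv.funSplitAt i β).symm (x, g) j) = w x * ∏ j, w (g j) := by
  rw [Fintype.prod_eq_mul_prod_subtype_ne _ i]
  congr 1
  · simp
  · exact Finset.prod_congr rfl fun j _ => by simp [j.2]

theorem sum_funSplitAt [Fintype ι] [DecidableEq ι] (s : β → ℕ) (i : ι) (x : β) (g : {j // j ≠ i} → β) :
    ∑ j, s ((Equiv.funSplitAt i β).symm (x, g) j) = s x + ∑ j, s (g j) := by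
  rw [Fintype.sum_eq_add_sum_subtype_ne _ i]
  congr 1
  · simp
  · exact Finset.sum_congr rfl fun j _ => by simp [j.2]

end PiSums

open Classical in
/-- The total weight of the trees satisfying `A`. -/
noncomputable def mass (p : ℕ → ℝ) (A : PTree → Prop) : ℝ≥0∞ :=
  ∑' T, if A T then eweight p T else 0

theorem mass_eq (p : ℕ → ℝ) (A : PTree → Prop) [DecidablePred A] :
    mass p A = ∑' T, if A T then eweight p T else 0 := by
  exact tsum_congr fun T => by by_cases h : A T <;> simp [h]

theorem mass_lt_height_succ {p : ℕ → ℝ} (hp : ∀ i, 0 ≤ p i) (h : ℕ) :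
    mass p (fun T => T.height < h + 1) =
      ∑' d, ENNReal.ofReal (p d) * mass p (fun T => T.height < h) ^ d := by
  classical
  rw [mass_eq, PTree.tsum_eq_tsum_tuple]
  refine tsum_congr fun d => ?_
  have : mass p (fun T => T.height < h) ^ d = ∑' f : Fin d → PTree,
      ∏ i, if (f i).height < h then eweight p (f i) else 0 := by
    rw [ENNReal.tsum_pi_prod (fun _ T => if T.height < h then eweight p T else 0)]
    simp [mass_eq]
  rw [this, ← ENNReal.tsum_mul_left]
  refine tsum_congr fun f => ?_
  have hlt : (PTree.node (List.ofFn f)).height < h + 1 ↔ ∀ i, (f i).height < h := by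
    have := (PTree.lt_height_node_ofFn_iff h f).not
    push Not at this
    exact this
  rw [eweight_node_ofFn hp]
  by_cases hf : ∀ i, (f i).height < h
  · rw [if_pos (hlt.2 hf)]
    congr 1
    exact Finset.prod_congr rfl fun i _ => by rw [if_pos (hf i)]
  · rw [if_neg (hlt.not.2 hf)]
    push Not at hf
    obtain ⟨i, hi⟩ := hf
    rw [Finset.prod_eq_zero (Finset.mem_univ i) (if_neg hi.not_gt), mul_zero]

theorem tsum_ofReal_eq_one {p : ℕ → ℝ} (hp : ∀ i, 0 ≤ p i) (h1 : HasSum p 1) :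
    ∑' d, ENNReal.ofReal (p d) = 1 := by
  rw [← ENNReal.ofReal_tsum_of_nonneg hp h1.summable, h1.tsum_eq, ENNReal.ofReal_one]

theorem mass_height_lt_le_one {p : ℕ → ℝ} (hp : ∀ i, 0 ≤ p i) (h1 : HasSum p 1) (h : ℕ) :
    mass p (fun T => T.height < h) ≤ 1 := by
  induction h with
  | zero => simp [mass_eq]
  | succ h ih =>
    rw [mass_lt_height_succ hp, ← tsum_ofReal_eq_one hp h1]
    exact ENNReal.tsum_le_tsum fun d => mul_le_of_le_one_right' (pow_le_one' ih d)

theorem tsum_eweight_le_one {p : ℕ → ℝ} (hp : ∀ i, 0 ≤ p i) (h1 : HasSum p 1) :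
    ∑' T, eweight p T ≤ 1 := by
  classical
  rw [ENNReal.tsum_eq_iSup_sum]
  refine iSup_le fun s => ?_
  refine le_trans ?_ (mass_height_lt_le_one hp h1 (s.sup PTree.height + 1))
  refine le_trans (Finset.sum_le_sum fun T hT => ?_) (ENNReal.sum_le_tsum s)
  rw [if_pos (Nat.lt_succ_of_le (Finset.le_sup (f := PTree.height) hT))]

theorem mass_le_one {p : ℕ → ℝ} (hp : ∀ i, 0 ≤ p i) (h1 : HasSum p 1) (A : PTree → Prop) :
    mass p A ≤ 1 := by
  classical
  refine le_trans (ENNReal.tsum_le_tsum fun T => ?_) (tsum_eweight_le_one hp h1)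
  split_ifs <;> simp

theorem mass_add_mass_not (p : ℕ → ℝ) (A : PTree → Prop) :
    mass p A + mass p (fun T => ¬ A T) = ∑' T, eweight p T := by
  classical
  rw [mass_eq, mass_eq, ← ENNReal.tsum_add]
  exact tsum_congr fun T => by by_cases h : A T <;> simp [h]

/-- Summing out one coordinate of a forest whose size is prescribed. -/
theorem tsum_forest_remove_le {ι : Type*} [Fintype ι] [DecidableEq ι] (p : ℕ → ℝ) (i : ι)
    (N : ℕ) (R : ℕ → Prop) (M : ℝ≥0∞) (hM : ∀ m ≤ N, R m → mass p (fun T => T.size = m) ≤ M)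
    (Φ : ({j // j ≠ i} → PTree) → ℝ≥0∞) (E : (ι → PTree) → Prop) [DecidablePred E]
    (hE : ∀ f, E f → ∑ j, (f j).size = N ∧ R (f i).size) :
    ∑' f : ι → PTree, (if E f then Φ (fun j => f j) * ∏ j, eweight p (f j) else 0) ≤
      M * ∑' g : {j // j ≠ i} → PTree, Φ g * ∏ j, eweight p (g j) := by
  classical
  rw [ENNReal.tsum_pi_eq_tsum_funSplitAt i, ENNReal.tsum_comm, ← ENNReal.tsum_mul_left]
  refine ENNReal.tsum_le_tsum fun g => ?_
  have hg : ∀ x, (fun j : {j // j ≠ i} => (Equiv.funSplitAt i PTree).symm (x, g) j) = g := by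
    intro x; ext j; simp [j.2]
  simp_rw [prod_funSplitAt, hg]
  set S := ∑ j, (g j).size
  have hE' : ∀ x, E ((Equiv.funSplitAt i PTree).symm (x, g)) → x.size + S = N ∧ R x.size := by
    intro x hx
    obtain ⟨h1, h2⟩ := hE _ hx
    rw [sum_funSplitAt] at h1
    refine ⟨h1, ?_⟩
    simpa using h2
  by_cases hx : ∃ x, E ((Equiv.funSplitAt i PTree).symm (x, g))
  · obtain ⟨x₀, hx₀⟩ := hx
    obtain ⟨h1, h2⟩ := hE' x₀ hx₀
    calc ∑' x, (if E ((Equiv.funSplitAt i PTree).symm (x, g)) then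
            Φ g * (eweight p x * ∏ j, eweight p (g j)) else 0)
        ≤ ∑' x, (if x.size = x₀.size then eweight p x else 0) *
            (Φ g * ∏ j, eweight p (g j)) := by
          refine ENNReal.tsum_le_tsum fun x => ?_
          split_ifs with h3 h4
          · rw [mul_left_comm]
          · exact absurd (by have := (hE' x h3).1; omega) h4
          · exact zero_le
          · exact zero_le
      _ = mass p (fun T => T.size = x₀.size) * (Φ g * ∏ j, eweight p (g j)) := by
          rw [ENNReal.tsum_mul_right, mass_eq]
      _ ≤ _ := by gcongr; exact hM _ (by omega) h2
  · push Not at hx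
    simp [hx]

/-- Forests with a marked tall tree, at least as large trees at each place of `J`. -/
theorem tsum_forest_dominated_le {ι : Type*} [Fintype ι] [DecidableEq ι] {p : ℕ → ℝ}
    (hp : ∀ i, 0 ≤ p i) (h1 : HasSum p 1) (i : ι) (J : Finset ι) (hi : i ∉ J)
    (A : PTree → Prop) [DecidablePred A] :
    ∑' g : ι → PTree, (if A (g i) ∧ ∀ j ∈ J, (g i).size ≤ (g j).size then 1 else 0) *
        ∏ j, eweight p (g j) ≤
      ∑' T, if A T then eweight p T * mass p (fun S => T.size ≤ S.size) ^ J.card else 0 := by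
  classical
  rw [ENNReal.tsum_pi_eq_tsum_funSplitAt i]
  refine ENNReal.tsum_le_tsum fun x => ?_
  simp_rw [prod_funSplitAt]
  by_cases hA : A x
  · rw [if_pos hA]
    have : ∀ g : {j // j ≠ i} → PTree,
        (if A ((Equiv.funSplitAt i PTree).symm (x, g) i) ∧
            ∀ j ∈ J, ((Equiv.funSplitAt i PTree).symm (x, g) i).size ≤
              ((Equiv.funSplitAt i PTree).symm (x, g) j).size then (1 : ℝ≥0∞) else 0) *
          (eweight p x * ∏ j, eweight p (g j)) ≤
        eweight p x * ∏ j : {j // j ≠ i}, if (j : ι) ∈ J → x.size ≤ (g j).size then eweight p (g j) else 0 := by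
      intro g
      split_ifs with h
      · rw [one_mul]
        gcongr with j
        rw [if_pos]
        intro hj
        have := h.2 j hj
        simpa [j.2] using this
      · simp
    refine (ENNReal.tsum_le_tsum this).trans ?_
    rw [ENNReal.tsum_mul_left, ENNReal.tsum_pi_prod
      (fun (j : {j // j ≠ i}) T => if (j : ι) ∈ J → x.size ≤ T.size then eweight p T else 0)]
    gcongr
    have h2 : ∀ j : {j // j ≠ i},
        (∑' T, if (j : ι) ∈ J → x.size ≤ T.size then eweight p T else 0) ≤
          if (j : ι) ∈ J then mass p (fun S => x.size ≤ S.size) else 1 := by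
      intro j
      split_ifs with hj
      · simp [mass_eq, hj]
      · simpa [mass_eq, hj] using mass_le_one hp h1 (fun T => (j : ι) ∈ J → x.size ≤ T.size)
    refine (Finset.prod_le_prod' fun j _ => h2 j).trans ?_
    have h3 := Fintype.prod_eq_mul_prod_subtype_ne
      (fun j => if j ∈ J then mass p (fun S => x.size ≤ S.size) else 1) i
    simp only [hi, if_false, one_mul] at h3
    rw [← h3, Finset.prod_ite_mem, Finset.univ_inter, Finset.prod_const]
  · simp [hA]

/-- A critical offspring law with finite third moment that is not concentrated on `{1}`. -/
structure CriticalLaw (p : ℕ → ℝ) : Prop where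
  nonneg : ∀ i, 0 ≤ p i
  hasSum : HasSum p 1
  mean : HasSum (fun i : ℕ => (i : ℝ) * p i) 1
  cube : Summable fun i : ℕ => (i : ℝ) ^ 3 * p i
  zero_pos : 0 < p 0
  exists_two_le : ∃ j, 2 ≤ j ∧ 0 < p j

theorem CriticalLaw.le_one {p : ℕ → ℝ} (hp : CriticalLaw p) (i : ℕ) : p i ≤ 1 :=
  le_hasSum hp.hasSum i fun j _ => hp.nonneg j

theorem CriticalLaw.sq {p : ℕ → ℝ} (hp : CriticalLaw p) :
    Summable fun i : ℕ => (i : ℝ) ^ 2 * p i := by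
  refine hp.cube.of_nonneg_of_le (fun i => mul_nonneg (by positivity) (hp.nonneg i)) fun i => ?_
  refine mul_le_mul_of_nonneg_right ?_ (hp.nonneg i)
  rcases Nat.eq_zero_or_pos i with rfl | hi
  · simp
  · exact pow_le_pow_right₀ (by exact_mod_cast hi) (by norm_num)

/-- The generating function `∑ w(T) s^|T|` restricted to trees of height at least `h`. -/
noncomputable def tallGen (p : ℕ → ℝ) (s : ℝ≥0∞) (h : ℕ) : ℝ≥0∞ :=
  ∑' T : PTree, if h ≤ T.height then eweight p T * s ^ T.size else 0

theorem eweight_mul_pow_node {p : ℕ → ℝ} (hp : ∀ i, 0 ≤ p i) (s : ℝ≥0∞) {d : ℕ}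
    (f : Fin d → PTree) :
    eweight p (.node (List.ofFn f)) * s ^ (PTree.node (List.ofFn f)).size =
      s * (ENNReal.ofReal (p d) * ∏ i, eweight p (f i) * s ^ (f i).size) := by
  rw [eweight_node_ofFn hp, PTree.size_node_ofFn, Finset.prod_mul_distrib,
    Finset.prod_pow_eq_pow_sum, pow_add, pow_one]
  ring

theorem tallGen_zero {p : ℕ → ℝ} (hp : ∀ i, 0 ≤ p i) (s : ℝ≥0∞) :
    tallGen p s 0 = s * ∑' d, ENNReal.ofReal (p d) * tallGen p s 0 ^ d := by
  have h0 : tallGen p s 0 = ∑' T, eweight p T * s ^ T.size := by simp [tallGen]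
  conv_lhs => rw [h0, PTree.tsum_eq_tsum_tuple]
  rw [← ENNReal.tsum_mul_left]
  refine tsum_congr fun d => ?_
  simp_rw [eweight_mul_pow_node hp, ENNReal.tsum_mul_left]
  rw [ENNReal.tsum_pi_prod (fun (_ : Fin d) T => eweight p T * s ^ T.size), h0]
  simp

theorem tallGen_succ_le {p : ℕ → ℝ} (hp : ∀ i, 0 ≤ p i) (s : ℝ≥0∞) (h : ℕ) :
    tallGen p s (h + 1) ≤
      s * (∑' d, ENNReal.ofReal (p d) * (d * tallGen p s 0 ^ (d - 1))) * tallGen p s h := by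
  have h0 : tallGen p s 0 = ∑' T, eweight p T * s ^ T.size := by simp [tallGen]
  rw [tallGen, PTree.tsum_eq_tsum_tuple, mul_assoc, ← ENNReal.tsum_mul_right,
    ← ENNReal.tsum_mul_left]
  refine ENNReal.tsum_le_tsum fun d => ?_
  set a : Fin d → Fin d → PTree → ℝ≥0∞ := fun i j T =>
    if j = i then (if h ≤ T.height then eweight p T * s ^ T.size else 0)
    else eweight p T * s ^ T.size with ha
  calc ∑' f : Fin d → PTree, (if h + 1 ≤ (PTree.node (List.ofFn f)).height then
          eweight p (.node (List.ofFn f)) * s ^ (PTree.node (List.ofFn f)).size else 0)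
      ≤ ∑' f : Fin d → PTree, s * (ENNReal.ofReal (p d) * ∑ i, ∏ j, a i j (f j)) := by
        refine ENNReal.tsum_le_tsum fun f => ?_
        split_ifs with hf
        · rw [PTree.lt_height_node_ofFn_iff] at hf
          obtain ⟨i, hi⟩ := hf
          rw [eweight_mul_pow_node hp]
          gcongr
          refine le_trans (le_of_eq ?_)
            (Finset.single_le_sum (f := fun i => ∏ j, a i j (f j)) (fun _ _ => zero_le)
              (Finset.mem_univ i))
          refine Finset.prod_congr rfl fun j _ => ?_
          simp only [ha]
          split_ifs with hj hh
          · rfl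
          · exact absurd hi (hj ▸ hh)
          · rfl
        · exact zero_le
    _ = s * (ENNReal.ofReal (p d) * ∑ i, ∏ j, ∑' T, a i j T) := by
        rw [ENNReal.tsum_mul_left, ENNReal.tsum_mul_left,
          Summable.tsum_finsetSum fun i _ => ENNReal.summable]
        simp_rw [ENNReal.tsum_pi_prod]
    _ = _ := by
        have : ∀ i : Fin d, ∏ j, ∑' T, a i j T = tallGen p s 0 ^ (d - 1) * tallGen p s h := by
          intro i
          rw [← Finset.mul_prod_erase _ _ (Finset.mem_univ i), mul_comm]
          congr 1
          · rw [h0, Finset.prod_congr rfl fun j hj =>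
              (tsum_congr fun T => if_neg (Finset.ne_of_mem_erase hj) :
                ∑' T, a i j T = ∑' T, eweight p T * s ^ T.size), Finset.prod_const]
            simp
          · simp [ha, tallGen]
        simp_rw [this, Finset.sum_const, Finset.card_univ, Fintype.card_fin, nsmul_eq_mul]
        ring

theorem tallGen_le_mass (p : ℕ → ℝ) {s : ℝ≥0∞} (hs : s ≤ 1) (h : ℕ) :
    tallGen p s h ≤ mass p (fun T => h ≤ T.height) := by
  rw [mass_eq]
  refine ENNReal.tsum_le_tsum fun T => ?_
  split_ifs
  · exact mul_le_of_le_one_right' (pow_le_one' hs _)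
  · exact le_rfl

section RealEstimates

theorem one_sub_pow_le_quadratic {x : ℝ} (h0 : 0 ≤ x) (h1 : x ≤ 1) (d : ℕ) :
    (1 - x) ^ d ≤ 1 - d * x + d ^ 2 * x ^ 2 := by
  induction d with
  | zero => simp
  | succ d ih =>
    have := mul_le_mul_of_nonneg_right ih (sub_nonneg.2 h1)
    rw [pow_succ]
    push_cast
    have h3 : 0 ≤ (d : ℝ) ^ 2 * x ^ 3 := by positivity
    have h4 : 0 ≤ (d : ℝ) * x ^ 2 := by positivity
    nlinarith

theorem quadratic_le_one_sub_pow {x : ℝ} (h1 : x ≤ 1) {d : ℕ} (hd : 2 ≤ d) :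
    1 - d * x + x ^ 2 ≤ (1 - x) ^ d := by
  induction d, hd using Nat.le_induction with
  | base => norm_num; nlinarith
  | succ d hd ih =>
    have := mul_le_mul_of_nonneg_right ih (sub_nonneg.2 h1)
    rw [pow_succ (1 - x) d]
    push_cast
    have h2 : (2 : ℝ) ≤ d := by exact_mod_cast hd
    nlinarith [mul_nonneg (sq_nonneg x) (show 0 ≤ (d : ℝ) - x by linarith)]

variable {p : ℕ → ℝ} (hp : CriticalLaw p)
include hp

theorem CriticalLaw.summable_mul_pow {y : ℝ} (h0 : 0 ≤ y) (h1 : y ≤ 1) :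
    Summable fun d => p d * y ^ d :=
  hp.hasSum.summable.of_nonneg_of_le (fun d => mul_nonneg (hp.nonneg d) (by positivity))
    fun d => mul_le_of_le_one_right (hp.nonneg d) (pow_le_one₀ h0 h1)

theorem CriticalLaw.genFun_le {x : ℝ} (h0 : 0 ≤ x) (h1 : x ≤ 1) :
    ∑' d, p d * (1 - x) ^ d ≤ 1 - x + (∑' d : ℕ, (d : ℝ) ^ 2 * p d) * x ^ 2 := by
  have h := (hp.hasSum.sub (hp.mean.mul_right x)).add (hp.sq.hasSum.mul_right (x ^ 2))
  rw [one_mul] at h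
  refine hasSum_le (fun d => ?_) (hp.summable_mul_pow (by linarith) (by linarith)).hasSum h
  have := mul_le_mul_of_nonneg_left (one_sub_pow_le_quadratic h0 h1 d) (hp.nonneg d)
  linarith

theorem CriticalLaw.le_genFun {j : ℕ} (hj : 2 ≤ j) {x : ℝ} (h0 : 0 ≤ x) (h1 : x ≤ 1) :
    1 - x + p j * x ^ 2 ≤ ∑' d, p d * (1 - x) ^ d := by
  have h := (hp.hasSum.sub (hp.mean.mul_right x)).add (hasSum_ite_eq j (p j * x ^ 2))
  rw [one_mul] at h
  refine hasSum_le (fun d => ?_) h (hp.summable_mul_pow (by linarith) (by linarith)).hasSum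
  split_ifs with hd
  · subst hd
    have := mul_le_mul_of_nonneg_left (quadratic_le_one_sub_pow h1 hj) (hp.nonneg d)
    linarith
  · have := mul_le_mul_of_nonneg_left
      (one_add_mul_le_pow (show (-2 : ℝ) ≤ -x by linarith) d) (hp.nonneg d)
    rw [← sub_eq_add_neg] at this
    linarith

theorem CriticalLaw.derivGenFun_le {j : ℕ} (hj : 2 ≤ j) {x : ℝ} (h0 : 0 ≤ x) (h1 : x ≤ 1) :
    (Summable fun d : ℕ => p d * (d * (1 - x) ^ (d - 1))) ∧
      ∑' d : ℕ, p d * (d * (1 - x) ^ (d - 1)) ≤ 1 - p j * x := by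
  have hpw : ∀ d : ℕ, (1 - x) ^ d ≤ 1 := fun d => pow_le_one₀ (by linarith) (by linarith)
  have hx : 0 ≤ 1 - x := by linarith
  have hs : Summable fun d : ℕ => p d * (d * (1 - x) ^ (d - 1)) := by
    refine hp.mean.summable.of_nonneg_of_le
      (fun d => mul_nonneg (hp.nonneg d) (by positivity)) fun d => ?_
    have := mul_le_of_le_one_right (mul_nonneg (Nat.cast_nonneg d) (hp.nonneg d)) (hpw (d - 1))
    linarith
  refine ⟨hs, hasSum_le (fun d => ?_) hs.hasSum (hp.mean.sub (hasSum_ite_eq j (p j * x)))⟩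
  have hd0 : (0 : ℝ) ≤ d * p d := mul_nonneg (Nat.cast_nonneg d) (hp.nonneg d)
  split_ifs with hd
  · subst hd
    have h2 : (1 - x) ^ (d - 1) ≤ 1 - x := by
      have := pow_le_pow_of_le_one hx (by linarith) (show 1 ≤ d - 1 by omega)
      rwa [pow_one] at this
    have h3 : (1 : ℝ) ≤ d := by exact_mod_cast (by omega : 1 ≤ d)
    have h4 := mul_le_mul_of_nonneg_left h2 hd0
    have h5 := mul_le_mul_of_nonneg_right h3 (mul_nonneg (hp.nonneg d) h0)
    linarith
  · have := mul_le_of_le_one_right hd0 (hpw (d - 1))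
    linarith

/-- Kolmogorov's estimate for the height of a critical tree. -/
theorem CriticalLaw.mass_le_height_le {j : ℕ} (hj : 2 ≤ j) (h : ℕ) :
    mass p (fun T => h ≤ T.height) ≤ ENNReal.ofReal (1 / (1 + p j * h)) := by
  have hlt1 := mass_height_lt_le_one hp.nonneg hp.hasSum
  have hfin : ∀ h, mass p (fun T => T.height < h) ≠ ∞ := fun h =>
    ne_top_of_le_ne_top ENNReal.one_ne_top (hlt1 h)
  set b : ℕ → ℝ := fun h => (mass p fun T => T.height < h).toReal with hb
  have hb0 : ∀ h, 0 ≤ b h := fun h => ENNReal.toReal_nonneg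
  have hb1 : ∀ h, b h ≤ 1 := fun h => by
    simpa using ENNReal.toReal_mono ENNReal.one_ne_top (hlt1 h)
  have hrec : ∀ h, b (h + 1) = ∑' d, p d * b h ^ d := by
    intro h
    simp only [hb]
    rw [mass_lt_height_succ hp.nonneg, ENNReal.tsum_toReal_eq fun d =>
      ENNReal.mul_ne_top ENNReal.ofReal_ne_top (ENNReal.pow_ne_top (hfin h))]
    simp [ENNReal.toReal_ofReal (hp.nonneg _)]
  have key : ∀ h : ℕ, (1 - b h) * (1 + p j * h) ≤ 1 := by
    intro h
    induction h with
    | zero => simpa using hb0 0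
    | succ h ih =>
      have h1 := hp.le_genFun hj (sub_nonneg.2 (hb1 h)) (by linarith [hb0 h])
      rw [sub_sub_cancel, ← hrec] at h1
      have hc0 := hp.nonneg j
      set x := 1 - b h
      have hx0 : 0 ≤ x := sub_nonneg.2 (hb1 h)
      have hx1 : 1 - b (h + 1) ≤ x - p j * x ^ 2 := by
        simp only [x] at h1 ⊢; linarith
      push_cast
      have hA : (0 : ℝ) ≤ 1 + p j * (h + 1) := by positivity
      refine (mul_le_mul_of_nonneg_right hx1 hA).trans ?_
      have h5 : 0 ≤ 1 - x * (1 + p j * h) := by linarith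
      have h6 : p j * x ≤ 1 := mul_le_one₀ (hp.le_one j) hx0 (by linarith [hb0 h])
      nlinarith [mul_nonneg (sub_nonneg.2 h6) h5, sq_nonneg (p j * x)]
  have hle : mass p (fun T => h ≤ T.height) + mass p (fun T => T.height < h) ≤ 1 := by
    have := mass_add_mass_not p (fun T => h ≤ T.height)
    simp only [not_le] at this
    rw [this]
    exact tsum_eweight_le_one hp.nonneg hp.hasSum
  have hpos : 0 < 1 + p j * h := by have := hp.nonneg j; positivity
  calc mass p (fun T => h ≤ T.height) ≤ 1 - mass p (fun T => T.height < h) :=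
        ENNReal.le_sub_of_add_le_right (hfin h) hle
    _ = ENNReal.ofReal (1 - b h) := by
        rw [ENNReal.ofReal_sub _ (hb0 h), ENNReal.ofReal_one, hb, ENNReal.ofReal_toReal (hfin h)]
    _ ≤ _ := ENNReal.ofReal_le_ofReal (by rw [le_div_iff₀ hpos]; exact key h)

theorem CriticalLaw.exists_tallGen_le : ∃ c : ℝ, 0 < c ∧ ∀ ε : ℝ, 0 ≤ ε → ε ≤ 1 → ∀ h h' : ℕ,
    tallGen p (ENNReal.ofReal (1 - ε)) (h + h') ≤
      ENNReal.ofReal (Real.exp (-(c * √ε * h'))) * mass p (fun T => h ≤ T.height) := by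
  obtain ⟨j, hj, hpj⟩ := hp.exists_two_le
  set K := ∑' d : ℕ, (d : ℝ) ^ 2 * p d
  have hK : 0 ≤ K := tsum_nonneg fun d => mul_nonneg (by positivity) (hp.nonneg d)
  refine ⟨p j / √(2 * K + 4), by positivity, fun ε h0 h1 h h' => ?_⟩
  set s := ENNReal.ofReal (1 - ε) with hs
  have hs1 : s ≤ 1 := by rw [hs, ENNReal.ofReal_le_one]; linarith
  have hy1 : tallGen p s 0 ≤ 1 := (tallGen_le_mass p hs1 0).trans (mass_le_one hp.nonneg hp.hasSum _)
  have hyfin : tallGen p s 0 ≠ ∞ := ne_top_of_le_ne_top ENNReal.one_ne_top hy1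
  set y := (tallGen p s 0).toReal with hy
  have hyof : tallGen p s 0 = ENNReal.ofReal y := (ENNReal.ofReal_toReal hyfin).symm
  have hy0 : 0 ≤ y := ENNReal.toReal_nonneg
  have hyle : y ≤ 1 := by simpa using ENNReal.toReal_mono ENNReal.one_ne_top hy1
  have hrec : y = (1 - ε) * ∑' d, p d * y ^ d := by
    conv_lhs => rw [hy, tallGen_zero hp.nonneg]
    rw [ENNReal.toReal_mul, ENNReal.tsum_toReal_eq fun d =>
      ENNReal.mul_ne_top ENNReal.ofReal_ne_top (ENNReal.pow_ne_top hyfin)]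
    simp [hs, hy, ENNReal.toReal_ofReal (hp.nonneg _), ENNReal.toReal_ofReal (sub_nonneg.2 h1)]
  set η := 1 - y with hη
  have hη0 : 0 ≤ η := by linarith
  have hη1 : η ≤ 1 := by linarith
  have hyη : y = 1 - η := by linarith
  have hηε : ε ≤ (2 * K + 4) * η ^ 2 := by
    have h2 := hp.genFun_le hη0 hη1
    rw [← hyη] at h2
    have h3 := mul_le_mul_of_nonneg_left h2 (sub_nonneg.2 h1)
    rw [← hrec] at h3
    have h4 : ε * y ≤ K * η ^ 2 := by
      nlinarith [mul_nonneg h0 (mul_nonneg hK (sq_nonneg η))]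
    rcases le_total (1 / 2) η with h5 | h5
    · nlinarith [mul_nonneg hK (sq_nonneg η)]
    · nlinarith [mul_nonneg h0 (show 0 ≤ y - 1 / 2 by linarith)]
  have hsq : √ε / √(2 * K + 4) ≤ η := by
    rw [div_le_iff₀ (by positivity)]
    refine (Real.sqrt_le_sqrt hηε).trans ?_
    rw [mul_comm, Real.sqrt_mul (by positivity), Real.sqrt_sq hη0]
  obtain ⟨hsum, hder⟩ := hp.derivGenFun_le hj hη0 hη1
  have hstep : ∀ h, tallGen p s (h + 1) ≤
      ENNReal.ofReal (Real.exp (-(p j / √(2 * K + 4) * √ε))) * tallGen p s h := by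
    intro h
    refine (tallGen_succ_le hp.nonneg s h).trans ?_
    gcongr
    have h6 : ∑' d : ℕ, ENNReal.ofReal (p d) * (d * tallGen p s 0 ^ (d - 1)) =
        ENNReal.ofReal (∑' d : ℕ, p d * (d * (1 - η) ^ (d - 1))) := by
      rw [ENNReal.ofReal_tsum_of_nonneg (fun d => ?_) hsum]
      · refine tsum_congr fun d => ?_
        rw [ENNReal.ofReal_mul (hp.nonneg d), ENNReal.ofReal_mul (by positivity), hyof,
          ENNReal.ofReal_pow (by linarith), ENNReal.ofReal_natCast, hyη]
      · exact mul_nonneg (hp.nonneg d) (mul_nonneg (by positivity) (pow_nonneg (by linarith) _))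
    rw [h6]
    refine (mul_le_of_le_one_left' hs1).trans (ENNReal.ofReal_le_ofReal (hder.trans ?_))
    refine le_trans ?_ (Real.one_sub_le_exp_neg _)
    have := mul_le_mul_of_nonneg_left hsq hpj.le
    have h7 : p j / √(2 * K + 4) * √ε = p j * (√ε / √(2 * K + 4)) := by ring
    rw [h7]; linarith
  induction h' with
  | zero => simpa using tallGen_le_mass p hs1 h
  | succ h' ih =>
    refine (hstep (h + h')).trans ((mul_le_mul_right ih _).trans (le_of_eq ?_))
    rw [← mul_assoc, ← ENNReal.ofReal_mul (Real.exp_pos _).le, ← Real.exp_add]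
    congr 3
    push_cast; ring

end RealEstimates

section TallTrees
variable {p : ℕ → ℝ} (hp : CriticalLaw p)
include hp

theorem CriticalLaw.exists_mass_tall_small_le : ∃ C c : ℝ, 0 < C ∧ 0 < c ∧ ∀ h : ℕ, 1 ≤ h → ∀ i : ℕ,
    mass p (fun T => 2 * h ≤ T.height ∧ i ^ 2 * T.size ≤ h ^ 2) ≤
      ENNReal.ofReal (C / h * Real.exp (-(c * i))) := by
  obtain ⟨c, hc, hcle⟩ := hp.exists_tallGen_le
  obtain ⟨j, hj, hpj⟩ := hp.exists_two_le
  refine ⟨2 / p j, c / √2, by positivity, by positivity, fun h hh i => ?_⟩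
  have hh0 : (0 : ℝ) < h := by exact_mod_cast hh
  by_cases hi : i ≤ h
  · set ε : ℝ := i ^ 2 / (2 * h ^ 2) with hε
    have hε0 : 0 ≤ ε := by positivity
    have hε1 : ε ≤ 1 := by
      rw [hε, div_le_one (by positivity)]
      have : (i : ℝ) ^ 2 ≤ h ^ 2 := by exact_mod_cast Nat.pow_le_pow_left hi 2
      nlinarith
    have h1 : mass p (fun T => 2 * h ≤ T.height ∧ i ^ 2 * T.size ≤ h ^ 2) ≤
        2 * tallGen p (ENNReal.ofReal (1 - ε)) (h + h) := by
      rw [mass_eq, tallGen, ← ENNReal.tsum_mul_left]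
      refine ENNReal.tsum_le_tsum fun T => ?_
      split_ifs with h2 h3 h3
      · have h4 : (i : ℝ) ^ 2 * T.size ≤ h ^ 2 := by exact_mod_cast h2.2
        have h5 : ε * T.size ≤ 1 / 2 := by
          rw [hε, div_mul_eq_mul_div, div_le_iff₀ (by positivity)]
          linarith
        have h6 : 1 / 2 ≤ (1 - ε) ^ T.size := by
          have := one_add_mul_le_pow (show (-2 : ℝ) ≤ -ε by linarith) T.size
          rw [← sub_eq_add_neg] at this
          linarith
        calc eweight p T = 2 * (eweight p T * ENNReal.ofReal (1 / 2)) := by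
              rw [mul_left_comm, one_div, ENNReal.ofReal_inv_of_pos two_pos, ENNReal.ofReal_ofNat,
                ENNReal.mul_inv_cancel two_ne_zero ENNReal.ofNat_ne_top, mul_one]
          _ ≤ _ := by
              rw [← ENNReal.ofReal_pow (sub_nonneg.2 hε1)]
              gcongr
      · omega
      · exact zero_le
      · exact zero_le
    have hsq : √ε = i / (√2 * h) := by
      rw [hε, Real.sqrt_div (by positivity), Real.sqrt_sq (by positivity),
        Real.sqrt_mul (by norm_num), Real.sqrt_sq hh0.le]
    refine h1.trans ((mul_le_mul_right ((hcle ε hε0 hε1 h h).trans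
      (mul_le_mul_right (hp.mass_le_height_le hj h) _)) 2).trans ?_)
    rw [← ENNReal.ofReal_ofNat, ← ENNReal.ofReal_mul (Real.exp_pos _).le,
      ← ENNReal.ofReal_mul (by norm_num)]
    refine ENNReal.ofReal_le_ofReal ?_
    have h7 : c * √ε * h = c / √2 * i := by rw [hsq]; field_simp
    have h8 : 1 / (1 + p j * h) ≤ 1 / (p j * h) :=
      one_div_le_one_div_of_le (by positivity) (by linarith)
    rw [h7]
    calc 2 * (Real.exp (-(c / √2 * i)) * (1 / (1 + p j * h)))
        ≤ 2 * (Real.exp (-(c / √2 * i)) * (1 / (p j * h))) := by gcongr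
      _ = _ := by field_simp
  · have : mass p (fun T => 2 * h ≤ T.height ∧ i ^ 2 * T.size ≤ h ^ 2) = 0 := by
      rw [mass_eq, ENNReal.tsum_eq_zero]
      intro T
      refine if_neg fun h2 => ?_
      have := T.size_pos
      nlinarith [h2.2]
    rw [this]
    exact zero_le

theorem CriticalLaw.exists_tsum_tall_inv_sqrt_pow_le_nat (j : ℕ) : ∃ C : ℝ, 0 < C ∧
    ∀ h : ℕ, 1 ≤ h → ∑' T : PTree,
      (if 2 * h ≤ T.height then eweight p T * ENNReal.ofReal ((1 / √T.size) ^ j) else 0) ≤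
        ENNReal.ofReal (C / h ^ (j + 1)) := by
  obtain ⟨C, c, hC, hc, hle⟩ := hp.exists_mass_tall_small_le
  have hs : Summable fun i : ℕ => ((i : ℝ) + 1) ^ j * Real.exp (-(c * i)) := by
    have h0 := (summable_nat_add_iff 1).2 (Real.summable_pow_mul_exp_neg_nat_mul j hc)
    refine (h0.mul_left (Real.exp c)).congr fun i => ?_
    rw [mul_left_comm, ← Real.exp_add]
    push_cast
    congr 2
    ring
  have hS : 0 < ∑' i : ℕ, ((i : ℝ) + 1) ^ j * Real.exp (-(c * i)) :=
    hs.tsum_pos (fun i => by positivity) 0 (by positivity)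
  refine ⟨C * ∑' i : ℕ, ((i : ℝ) + 1) ^ j * Real.exp (-(c * i)), by positivity, fun h hh => ?_⟩
  have hh0 : (0 : ℝ) < h := by exact_mod_cast hh
  have hpt : ∀ T : PTree,
      (if 2 * h ≤ T.height then eweight p T * ENNReal.ofReal ((1 / √T.size) ^ j) else 0) ≤
        ∑' i : ℕ, ENNReal.ofReal ((1 / h) ^ j * ((i : ℝ) + 1) ^ j) *
          if 2 * h ≤ T.height ∧ i ^ 2 * T.size ≤ h ^ 2 then eweight p T else 0 := by
    intro T
    split_ifs with hT
    · have hm : (0 : ℝ) < T.size := by exact_mod_cast T.size_pos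
      set i := ⌊h / √T.size⌋₊ with hi
      have h1 : (i : ℝ) ≤ h / √T.size := Nat.floor_le (by positivity)
      have h2 : h / √T.size < i + 1 := Nat.lt_floor_add_one _
      have h3 : i ^ 2 * T.size ≤ h ^ 2 := by
        rw [le_div_iff₀ (by positivity)] at h1
        have := pow_le_pow_left₀ (by positivity) h1 2
        rw [mul_pow, Real.sq_sqrt hm.le] at this
        exact_mod_cast this
      refine le_trans ?_ (ENNReal.le_tsum i)
      rw [if_pos ⟨hT, h3⟩, mul_comm]
      gcongr
      rw [← mul_pow]
      gcongr
      calc 1 / √T.size = 1 / h * (h / √T.size) := by field_simp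
        _ ≤ _ := by gcongr
    · exact zero_le
  calc _ ≤ ∑' T : PTree, ∑' i : ℕ, ENNReal.ofReal ((1 / h) ^ j * ((i : ℝ) + 1) ^ j) *
          (if 2 * h ≤ T.height ∧ i ^ 2 * T.size ≤ h ^ 2 then eweight p T else 0) :=
        ENNReal.tsum_le_tsum hpt
    _ = ∑' i : ℕ, ENNReal.ofReal ((1 / h) ^ j * ((i : ℝ) + 1) ^ j) *
          mass p (fun T => 2 * h ≤ T.height ∧ i ^ 2 * T.size ≤ h ^ 2) := by
        rw [ENNReal.tsum_comm]
        simp_rw [ENNReal.tsum_mul_left, mass_eq]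
    _ ≤ ∑' i : ℕ, ENNReal.ofReal
          (C / h ^ (j + 1) * (((i : ℝ) + 1) ^ j * Real.exp (-(c * i)))) := by
        refine ENNReal.tsum_le_tsum fun i => (mul_le_mul_right (hle h hh i) _).trans (le_of_eq ?_)
        rw [← ENNReal.ofReal_mul (by positivity)]
        congr 1
        rw [one_div, inv_pow, pow_succ]
        field_simp
    _ = ENNReal.ofReal (C / h ^ (j + 1) * ∑' i : ℕ, ((i : ℝ) + 1) ^ j * Real.exp (-(c * i))) := by
        rw [← ENNReal.ofReal_tsum_of_nonneg (fun i => by positivity) (hs.mul_left _),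
          tsum_mul_left]
    _ = _ := by congr 1; ring

theorem CriticalLaw.exists_tsum_tall_inv_sqrt_pow_le (j : ℕ) : ∃ C : ℝ, 0 < C ∧
    ∀ t : ℝ, 1 ≤ t → ∑' T : PTree,
      (if t ≤ T.height then eweight p T * ENNReal.ofReal ((1 / √T.size) ^ j) else 0) ≤
        ENNReal.ofReal (C / t ^ (j + 1)) := by
  obtain ⟨C, hC, hle⟩ := hp.exists_tsum_tall_inv_sqrt_pow_le_nat j
  refine ⟨max (2 ^ (j + 1)) (C * 4 ^ (j + 1)), by positivity, fun t ht => ?_⟩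
  have ht0 : 0 < t := by linarith
  rcases lt_or_ge t 2 with ht2 | ht2
  · calc _ ≤ ∑' T : PTree, eweight p T := by
          refine ENNReal.tsum_le_tsum fun T => ?_
          split_ifs
          · refine mul_le_of_le_one_right' (ENNReal.ofReal_le_one.2 (pow_le_one₀ (by positivity) ?_))
            have : (1 : ℝ) ≤ T.size := by exact_mod_cast T.size_pos
            exact div_le_one_of_le₀ (Real.one_le_sqrt.2 this) (by positivity)
          · exact zero_le
      _ ≤ 1 := tsum_eweight_le_one hp.nonneg hp.hasSum
      _ ≤ _ := by
          rw [ENNReal.one_le_ofReal, one_le_div (by positivity)]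
          exact le_trans (pow_le_pow_left₀ ht0.le ht2.le _) (le_max_left _ _)
  · set h := ⌊t / 2⌋₊ with hh
    have h1 : (h : ℝ) ≤ t / 2 := Nat.floor_le (by positivity)
    have h2 : t / 2 < h + 1 := Nat.lt_floor_add_one _
    have h3 : 1 ≤ h := Nat.le_floor (by push_cast; linarith)
    have h3' : (1 : ℝ) ≤ h := by exact_mod_cast h3
    have h4 : t ≤ 4 * h := by linarith
    calc _ ≤ ∑' T : PTree, (if 2 * h ≤ T.height then
              eweight p T * ENNReal.ofReal ((1 / √T.size) ^ j) else 0) := by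
          refine ENNReal.tsum_le_tsum fun T => ?_
          split_ifs with h5 h6
          · exact le_rfl
          · exact absurd (by exact_mod_cast (by linarith : (2 : ℝ) * h ≤ T.height)) h6
          · exact zero_le
          · exact le_rfl
      _ ≤ ENNReal.ofReal (C / h ^ (j + 1)) := hle h h3
      _ ≤ _ := by
          refine ENNReal.ofReal_le_ofReal ?_
          rw [div_le_div_iff₀ (by positivity) (by positivity)]
          calc C * t ^ (j + 1) ≤ C * (4 * h) ^ (j + 1) := by gcongr
            _ = C * 4 ^ (j + 1) * h ^ (j + 1) := by rw [mul_pow]; ring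
            _ ≤ _ := by gcongr; exact le_max_right _ _

end TallTrees

/-- The total weight of the forests of `d` trees with `n` nodes. -/
noncomputable def forestMass (p : ℕ → ℝ) (d n : ℕ) : ℝ≥0∞ :=
  ∑' f : Fin d → PTree, if ∑ i, (f i).size = n then ∏ i, eweight p (f i) else 0

theorem mass_size_succ {p : ℕ → ℝ} (hp : ∀ i, 0 ≤ p i) (n : ℕ) :
    mass p (fun T => T.size = n + 1) = ∑' d, ENNReal.ofReal (p d) * forestMass p d n := by
  rw [mass_eq, PTree.tsum_eq_tsum_tuple]
  refine tsum_congr fun d => ?_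
  rw [forestMass, ← ENNReal.tsum_mul_left]
  refine tsum_congr fun f => ?_
  rw [eweight_node_ofFn hp, PTree.size_node_ofFn, mul_ite, mul_zero]
  exact if_congr (by omega) rfl rfl

theorem mass_size_zero (p : ℕ → ℝ) : mass p (fun T => T.size = 0) = 0 := by
  simp [mass_eq, T_ne]
where T_ne : ∀ T : PTree, T.size ≠ 0 := fun T => T.size_pos.ne'

theorem forestMass_succ (p : ℕ → ℝ) (d n : ℕ) : forestMass p (d + 1) n =
    ∑ ab ∈ Finset.HasAntidiagonal.antidiagonal n, mass p (fun T => T.size = ab.1) * forestMass p d ab.2 := by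
  have hpt : ∀ (x : PTree) (g : Fin d → PTree),
      (if x.size + ∑ i, (g i).size = n then eweight p x * ∏ i, eweight p (g i) else 0) =
        ∑ ab ∈ Finset.HasAntidiagonal.antidiagonal n, (if x.size = ab.1 then eweight p x else 0) *
          if ∑ i, (g i).size = ab.2 then ∏ i, eweight p (g i) else 0 := by
    intro x g
    split_ifs with h
    · rw [Finset.sum_eq_single (x.size, ∑ i, (g i).size)]
      · simp
      · rintro ⟨a, b⟩ - hne
        by_cases ha : x.size = a
        · have hb : ∑ i, (g i).size ≠ b := fun hb => hne (by rw [ha, hb])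
          simp [hb]
        · simp [ha]
      · intro h'
        exact absurd (Finset.HasAntidiagonal.mem_antidiagonal.2 h) h'
    · refine (Finset.sum_eq_zero ?_).symm
      rintro ⟨a, b⟩ hab
      by_cases ha : x.size = a
      · have hb : ∑ i, (g i).size ≠ b := fun hb => h (by
          rw [ha, hb]; exact Finset.HasAntidiagonal.mem_antidiagonal.1 hab)
        simp [hb]
      · simp [ha]
  rw [forestMass, ENNReal.tsum_fin_cons]
  simp only [Fin.sum_univ_succ, Fin.prod_univ_succ, Fin.cons_zero, Fin.cons_succ, hpt]
  simp_rw [Summable.tsum_finsetSum fun _ _ => ENNReal.summable, ENNReal.tsum_mul_left,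
    ENNReal.tsum_mul_right, mass_eq, forestMass]

/-- The generating series of the sizes of trees. -/
noncomputable def sizeSeries (p : ℕ → ℝ) : PowerSeries ℝ :=
  PowerSeries.mk fun n => (mass p fun T => T.size = n).toReal

section Lagrange
variable {p : ℕ → ℝ} (hp : ∀ i, 0 ≤ p i) (h1 : HasSum p 1)
include hp h1

theorem mass_ne_top (A : PTree → Prop) : mass p A ≠ ∞ :=
  ne_top_of_le_ne_top ENNReal.one_ne_top (mass_le_one hp h1 A)

theorem coeff_sizeSeries_pow (d n : ℕ) : forestMass p d n ≠ ∞ ∧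
    PowerSeries.coeff n (sizeSeries p ^ d) = (forestMass p d n).toReal := by
  induction d generalizing n with
  | zero =>
    rw [pow_zero, PowerSeries.coeff_one]
    by_cases hn : n = 0
    · subst hn; simp [forestMass]
    · simp [forestMass, hn, Ne.symm hn]
  | succ d ih =>
    have hfin : ∀ ab ∈ Finset.HasAntidiagonal.antidiagonal n,
        mass p (fun T => T.size = ab.1) * forestMass p d ab.2 ≠ ∞ :=
      fun ab _ => ENNReal.mul_ne_top (mass_ne_top hp h1 _) (ih ab.2).1
    rw [forestMass_succ]
    refine ⟨ENNReal.sum_ne_top.2 hfin, ?_⟩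
    rw [pow_succ', PowerSeries.coeff_mul, ENNReal.toReal_sum hfin]
    refine Finset.sum_congr rfl fun ab _ => ?_
    rw [ENNReal.toReal_mul, (ih ab.2).2, sizeSeries, PowerSeries.coeff_mk]

omit hp h1 in
theorem coeff_sizeSeries_pow_of_lt {d n : ℕ} (h : n < d) :
    PowerSeries.coeff n (sizeSeries p ^ d) = 0 := by
  refine PowerSeries.coeff_of_lt_order _ ?_
  refine lt_of_lt_of_le (by exact_mod_cast h) (PowerSeries.le_order_pow_of_constantCoeff_eq_zero d ?_)
  rw [← PowerSeries.coeff_zero_eq_constantCoeff_apply, sizeSeries, PowerSeries.coeff_mk,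
    mass_size_zero, ENNReal.toReal_zero]

theorem coeff_sizeSeries_succ (n N : ℕ) (hN : n ≤ N) :
    PowerSeries.coeff (n + 1) (sizeSeries p) =
      ∑ d ∈ Finset.range (N + 1), p d * PowerSeries.coeff n (sizeSeries p ^ d) := by
  rw [sizeSeries, PowerSeries.coeff_mk, mass_size_succ hp, ENNReal.tsum_toReal_eq fun d =>
    ENNReal.mul_ne_top ENNReal.ofReal_ne_top (coeff_sizeSeries_pow hp h1 d n).1, ← sizeSeries]
  have : ∀ d, (ENNReal.ofReal (p d) * forestMass p d n).toReal =
      p d * PowerSeries.coeff n (sizeSeries p ^ d) := fun d => by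
    rw [ENNReal.toReal_mul, ENNReal.toReal_ofReal (hp d), (coeff_sizeSeries_pow hp h1 d n).2]
  simp_rw [this]
  refine tsum_eq_sum fun d hd => ?_
  rw [coeff_sizeSeries_pow_of_lt, mul_zero]
  simp only [Finset.mem_range] at hd
  omega

theorem coeff_sizeSeries_pow_succ (r n : ℕ) :
    PowerSeries.coeff (n + 1) (sizeSeries p ^ (r + 1)) =
      ∑ d ∈ Finset.range (n + 1), p d * PowerSeries.coeff n (sizeSeries p ^ (r + d)) := by
  rw [pow_succ', PowerSeries.coeff_mul, Finset.Nat.sum_antidiagonal_succ]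
  have h0 : PowerSeries.coeff 0 (sizeSeries p) = 0 := by
    rw [sizeSeries, PowerSeries.coeff_mk, mass_size_zero, ENNReal.toReal_zero]
  rw [h0, zero_mul, zero_add]
  have : ∀ ab ∈ Finset.HasAntidiagonal.antidiagonal n, PowerSeries.coeff (ab.1 + 1) (sizeSeries p) *
      PowerSeries.coeff ab.2 (sizeSeries p ^ r) = ∑ d ∈ Finset.range (n + 1),
        p d * (PowerSeries.coeff ab.1 (sizeSeries p ^ d) *
          PowerSeries.coeff ab.2 (sizeSeries p ^ r)) := by
    intro ab hab
    rw [coeff_sizeSeries_succ hp h1 ab.1 n (by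
      have := Finset.HasAntidiagonal.mem_antidiagonal.1 hab; omega), Finset.sum_mul]
    exact Finset.sum_congr rfl fun d _ => mul_assoc _ _ _
  rw [Finset.sum_congr rfl this, Finset.sum_comm]
  refine Finset.sum_congr rfl fun d _ => ?_
  rw [← Finset.mul_sum, add_comm r d, pow_add, PowerSeries.coeff_mul]

omit hp h1 in
theorem sum_mul_coeff_pow (p : ℕ → ℝ) (n N : ℕ) :
    ∑ d ∈ Finset.range (N + 1),
        (d : ℝ) * p d * PowerSeries.coeff (N - d) (PowerSeries.mk p ^ n) * (n + 1) =
      N * PowerSeries.coeff N (PowerSeries.mk p ^ (n + 1)) := by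
  cases N with
  | zero => simp
  | succ N =>
    have h := congrArg (PowerSeries.coeff N)
      (Derivation.leibniz_pow (PowerSeries.derivative ℝ) (PowerSeries.mk p) (n + 1))
    simp only [Nat.add_sub_cancel, smul_eq_mul] at h
    rw [PowerSeries.coeff_derivative] at h
    rw [Finset.sum_range_succ', Nat.cast_zero, zero_mul, zero_mul, zero_mul, add_zero]
    push_cast
    rw [mul_comm, h, ← Finset.sum_mul, mul_comm, map_nsmul, nsmul_eq_mul, mul_comm (_ ^ n),
      PowerSeries.coeff_mul, Finset.Nat.sum_antidiagonal_eq_sum_range_succ_mk]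
    push_cast
    congr 1
    refine Finset.sum_congr rfl fun d _ => ?_
    rw [PowerSeries.coeff_derivative, PowerSeries.coeff_mk]
    ring

/-- The hitting time theorem (Otter–Dwass formula) for forests. -/
theorem mul_coeff_sizeSeries_pow (n r : ℕ) (hr : 1 ≤ r) (hrn : r ≤ n) :
    n * PowerSeries.coeff n (sizeSeries p ^ r) =
      r * PowerSeries.coeff (n - r) (PowerSeries.mk p ^ n) := by
  induction n generalizing r with
  | zero => omega
  | succ N ih =>
    obtain ⟨R, rfl⟩ : ∃ R, r = R + 1 := ⟨r - 1, by omega⟩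
    rw [coeff_sizeSeries_pow_succ hp h1, Nat.add_sub_add_right]
    rcases Nat.eq_zero_or_pos N with rfl | hN
    · obtain rfl : R = 0 := by omega
      simp
    have hRN : R ≤ N := by omega
    have hN0 : (N : ℝ) ≠ 0 := by positivity
    have hterm : N * ∑ d ∈ Finset.range (N + 1), p d * PowerSeries.coeff N (sizeSeries p ^ (R + d))
        = ∑ d ∈ Finset.range (N - R + 1),
          p d * ((R + d) * PowerSeries.coeff (N - R - d) (PowerSeries.mk p ^ N)) := by
      rw [Finset.mul_sum]
      symm
      refine Finset.sum_subset_zero_on_sdiff (by simp [Finset.range_subset_range]) ?_ ?_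
      · intro d hd
        simp only [Finset.mem_sdiff, Finset.mem_range] at hd
        rw [coeff_sizeSeries_pow_of_lt (by omega), mul_zero, mul_zero]
      · intro d hd
        simp only [Finset.mem_range] at hd
        rcases Nat.eq_zero_or_pos (R + d) with h0 | h0
        · have hR : R = 0 := by omega
          have hd0 : d = 0 := by omega
          subst hR hd0
          simp [PowerSeries.coeff_one, hN.ne']
        · have := ih (R + d) h0 (by omega)
          rw [Nat.sub_sub]
          push_cast at this
          rw [← this]
          ring
    have hconv : PowerSeries.coeff (N - R) (PowerSeries.mk p ^ (N + 1)) =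
        ∑ d ∈ Finset.range (N - R + 1), p d * PowerSeries.coeff (N - R - d) (PowerSeries.mk p ^ N) := by
      rw [pow_succ', PowerSeries.coeff_mul, Finset.Nat.sum_antidiagonal_eq_sum_range_succ_mk]
      simp
    have hex := sum_mul_coeff_pow p N (N - R)
    rw [← Finset.sum_mul] at hex
    have hsplit : ∑ d ∈ Finset.range (N - R + 1),
          p d * ((R + d) * PowerSeries.coeff (N - R - d) (PowerSeries.mk p ^ N)) =
        R * PowerSeries.coeff (N - R) (PowerSeries.mk p ^ (N + 1)) +
          ∑ d ∈ Finset.range (N - R + 1),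
            (d : ℝ) * p d * PowerSeries.coeff (N - R - d) (PowerSeries.mk p ^ N) := by
      rw [hconv, Finset.mul_sum, ← Finset.sum_add_distrib]
      exact Finset.sum_congr rfl fun d _ => by ring
    rw [hsplit] at hterm
    refine mul_left_cancel₀ hN0 ?_
    rw [mul_left_comm, hterm]
    push_cast [hRN] at hex ⊢
    linear_combination hex

theorem mul_mass_size (n : ℕ) (hn : 1 ≤ n) :
    n * (mass p fun T => T.size = n).toReal =
      PowerSeries.coeff (n - 1) (PowerSeries.mk p ^ n) := by
  have := mul_coeff_sizeSeries_pow hp h1 n 1 le_rfl hn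
  rwa [pow_one, sizeSeries, PowerSeries.coeff_mk, Nat.cast_one, one_mul] at this

end Lagrange

/-- The characteristic function `θ ↦ ∑ p_j e^{ijθ}`. -/
noncomputable def offspringChar (p : ℕ → ℝ) (θ : ℝ) : ℂ :=
  ∑' j : ℕ, (p j : ℂ) * Complex.exp (θ * Complex.I) ^ j

theorem norm_exp_pow_eq_one (θ : ℝ) (m : ℕ) : ‖Complex.exp (θ * Complex.I) ^ m‖ = 1 := by
  rw [norm_pow, Complex.norm_exp_ofReal_mul_I, one_pow]

section CharFun
variable {p : ℕ → ℝ} (hp : CriticalLaw p)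
include hp

theorem CriticalLaw.norm_term (θ : ℝ) (j : ℕ) :
    ‖(p j : ℂ) * Complex.exp (θ * Complex.I) ^ j‖ = p j := by
  rw [norm_mul, norm_exp_pow_eq_one, mul_one, Complex.norm_real, Real.norm_of_nonneg (hp.nonneg j)]

theorem CriticalLaw.summable_norm_term (θ : ℝ) :
    Summable fun j => ‖(p j : ℂ) * Complex.exp (θ * Complex.I) ^ j‖ := by
  simp_rw [hp.norm_term θ]
  exact hp.hasSum.summable

theorem CriticalLaw.continuous_offspringChar : Continuous (offspringChar p) := by
  refine continuous_tsum (fun j => by fun_prop) hp.hasSum.summable fun j θ => ?_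
  rw [hp.norm_term]

theorem CriticalLaw.hasSum_offspringChar_pow (n : ℕ) (θ : ℝ) :
    (Summable fun m => ‖((PowerSeries.coeff m (PowerSeries.mk p ^ n) : ℝ) : ℂ) *
        Complex.exp (θ * Complex.I) ^ m‖) ∧
      ∑' m, ((PowerSeries.coeff m (PowerSeries.mk p ^ n) : ℝ) : ℂ) * Complex.exp (θ * Complex.I) ^ m =
        offspringChar p θ ^ n := by
  induction n with
  | zero =>
    have : ∀ m, m ∉ ({0} : Finset ℕ) → ((PowerSeries.coeff m (PowerSeries.mk p ^ 0) : ℝ) : ℂ) *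
        Complex.exp (θ * Complex.I) ^ m = 0 := fun m hm => by
      rw [pow_zero, PowerSeries.coeff_one, if_neg (by simpa using hm)]; simp
    refine ⟨summable_of_ne_finset_zero (s := {0}) fun m hm => by rw [this m hm, norm_zero], ?_⟩
    rw [tsum_eq_sum this]
    simp
  | succ n ih =>
    have h := tsum_mul_tsum_eq_tsum_sum_antidiagonal_of_summable_norm ih.1
      (hp.summable_norm_term θ)
    have h2 := summable_norm_sum_mul_antidiagonal_of_summable_norm ih.1
      (hp.summable_norm_term θ)
    have h3 : ∀ m, ∑ kl ∈ Finset.HasAntidiagonal.antidiagonal m,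
        ((PowerSeries.coeff kl.1 (PowerSeries.mk p ^ n) : ℝ) : ℂ) * Complex.exp (θ * Complex.I) ^ kl.1 *
          ((p kl.2 : ℂ) * Complex.exp (θ * Complex.I) ^ kl.2) =
        ((PowerSeries.coeff m (PowerSeries.mk p ^ (n + 1)) : ℝ) : ℂ) *
          Complex.exp (θ * Complex.I) ^ m := by
      intro m
      rw [pow_succ, PowerSeries.coeff_mul, Complex.ofReal_sum, Finset.sum_mul]
      refine Finset.sum_congr rfl fun kl hkl => ?_
      rw [← Finset.HasAntidiagonal.mem_antidiagonal.1 hkl, pow_add, PowerSeries.coeff_mk]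
      push_cast
      ring
    simp_rw [h3] at h h2
    exact ⟨h2, by rw [← h, ih.2, pow_succ]; rfl⟩

theorem CriticalLaw.coeff_pow_nonneg (n m : ℕ) :
    0 ≤ PowerSeries.coeff m (PowerSeries.mk p ^ n) := by
  induction n generalizing m with
  | zero => rw [pow_zero, PowerSeries.coeff_one]; split_ifs <;> norm_num
  | succ n ih =>
    rw [pow_succ, PowerSeries.coeff_mul]
    exact Finset.sum_nonneg fun kl _ =>
      mul_nonneg (ih _) (by rw [PowerSeries.coeff_mk]; exact hp.nonneg _)

theorem CriticalLaw.summable_coeff_pow (n : ℕ) :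
    Summable fun m => PowerSeries.coeff m (PowerSeries.mk p ^ n) := by
  refine (hp.hasSum_offspringChar_pow n 0).1.congr fun m => ?_
  rw [norm_mul, norm_exp_pow_eq_one, mul_one, Complex.norm_real,
    Real.norm_of_nonneg (hp.coeff_pow_nonneg n m)]

omit hp in
theorem norm_add_mul_le {a b : ℝ} (ha : 0 ≤ a) (hb : 0 ≤ b) (hab : a + b ≤ 1) {w : ℂ}
    (hw : ‖w‖ = 1) : ‖(a : ℂ) + b * w‖ ≤ a + b - a * b / 2 * ‖w - 1‖ ^ 2 := by
  have hw2 : w.re ^ 2 + w.im ^ 2 = 1 := by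
    have := Complex.sq_norm w
    rw [hw, Complex.normSq_apply] at this
    nlinarith
  have h1 : ‖(a : ℂ) + b * w‖ ^ 2 = (a + b) ^ 2 - a * b * ‖w - 1‖ ^ 2 := by
    rw [Complex.sq_norm, Complex.sq_norm, Complex.normSq_apply, Complex.normSq_apply]
    simp
    linear_combination (b ^ 2 + a * b) * hw2
  have h2 : ‖w - 1‖ ^ 2 ≤ 4 := by
    have : ‖w - 1‖ ≤ 2 := (norm_sub_le _ _).trans (by rw [hw, norm_one]; norm_num)
    nlinarith [norm_nonneg (w - 1)]
  set X := ‖w - 1‖ ^ 2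
  have hX : 0 ≤ X := by positivity
  have hab0 := mul_nonneg ha hb
  refine abs_le_of_sq_le_sq' ?_ ?_ |>.2
  · rw [h1]
    nlinarith [mul_nonneg (mul_nonneg hab0 hX) (sub_nonneg.2 hab), sq_nonneg (a * b / 2 * X)]
  · nlinarith [mul_nonneg hab0 (sub_nonneg.2 h2), mul_nonneg ha (sub_nonneg.2 hab),
      mul_nonneg hb (sub_nonneg.2 hab)]

theorem CriticalLaw.norm_offspringChar_le {j : ℕ} (hj : 1 ≤ j) (θ : ℝ) :
    ‖offspringChar p θ‖ ≤ 1 - p 0 * p j / 2 * ‖Complex.exp (θ * Complex.I) ^ j - 1‖ ^ 2 := by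
  have hs := (hp.summable_norm_term θ).of_norm
  have hne : (0 : ℕ) ∉ ({j} : Finset ℕ) := by simp; omega
  have e1 := hs.sum_add_tsum_compl (s := {0, j})
  have e2 := hp.hasSum.summable.sum_add_tsum_compl (s := {0, j})
  rw [hp.hasSum.tsum_eq, Finset.sum_insert hne, Finset.sum_singleton] at e2
  rw [Finset.sum_insert hne, Finset.sum_singleton, pow_zero, mul_one] at e1
  rw [offspringChar, ← e1]
  have hsc : Summable fun x : ↑(({0, j} : Finset ℕ) : Set ℕ)ᶜ => p x :=
    hp.hasSum.summable.subtype _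
  have h3 : ‖∑' x : ↑(({0, j} : Finset ℕ) : Set ℕ)ᶜ,
      (p x : ℂ) * Complex.exp (θ * Complex.I) ^ (x : ℕ)‖ ≤
        ∑' x : ↑(({0, j} : Finset ℕ) : Set ℕ)ᶜ, p x :=
    tsum_of_norm_bounded hsc.hasSum fun x => (hp.norm_term θ x).le
  have h4 : 0 ≤ ∑' x : ↑(({0, j} : Finset ℕ) : Set ℕ)ᶜ, p x := tsum_nonneg fun x => hp.nonneg _
  have h5 := norm_add_mul_le (hp.nonneg 0) (hp.nonneg j) (by linarith) (norm_exp_pow_eq_one θ j)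
  refine (norm_add_le _ _).trans ?_
  linarith

theorem CriticalLaw.norm_offspringChar_le_one (θ : ℝ) : ‖offspringChar p θ‖ ≤ 1 :=
  tsum_of_norm_bounded hp.hasSum fun j => (hp.norm_term θ j).le

omit hp in
/-- The integers `m` for which `e^{imθ}` is close to `1` whenever the modulus of the
characteristic function is close to `1`. -/
noncomputable def offspringPeriodGroup (p : ℕ → ℝ) : AddSubgroup ℤ where
  carrier := {m | ∃ C : ℝ, ∀ θ : ℝ,
    ‖Complex.exp (θ * Complex.I) ^ m - 1‖ ^ 2 ≤ C * (1 - ‖offspringChar p θ‖)}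
  zero_mem' := ⟨0, fun θ => by simp⟩
  add_mem' := by
    rintro m m' ⟨C, hC⟩ ⟨C', hC'⟩
    refine ⟨2 * C + 2 * C', fun θ => ?_⟩
    set z := Complex.exp (θ * Complex.I)
    have hz : ‖z ^ m‖ = 1 := by rw [norm_zpow, Complex.norm_exp_ofReal_mul_I, one_zpow]
    have h1 : ‖z ^ (m + m') - 1‖ ≤ ‖z ^ m' - 1‖ + ‖z ^ m - 1‖ := by
      have : z ^ (m + m') - 1 = z ^ m * (z ^ m' - 1) + (z ^ m - 1) := by
        rw [zpow_add₀ (Complex.exp_ne_zero _)]; ring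
      rw [this]
      refine (norm_add_le _ _).trans ?_
      rw [norm_mul, hz, one_mul]
    have h2 := pow_le_pow_left₀ (norm_nonneg _) h1 2
    nlinarith [hC θ, hC' θ, sq_nonneg (‖z ^ m' - 1‖ - ‖z ^ m - 1‖)]
  neg_mem' := by
    rintro m ⟨C, hC⟩
    refine ⟨C, fun θ => ?_⟩
    set z := Complex.exp (θ * Complex.I)
    have hz : ‖z ^ m‖ = 1 := by rw [norm_zpow, Complex.norm_exp_ofReal_mul_I, one_zpow]
    have h1 : ‖z ^ (-m) - 1‖ = ‖z ^ m - 1‖ := by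
      have h0 : z ^ m ≠ 0 := zpow_ne_zero _ (Complex.exp_ne_zero _)
      have : z ^ (-m) - 1 = -((z ^ m)⁻¹ * (z ^ m - 1)) := by
        rw [zpow_neg]; field_simp; ring
      rw [this, norm_neg, norm_mul, norm_inv, hz, inv_one, one_mul]
    rw [h1]
    exact hC θ

theorem CriticalLaw.mem_offspringPeriodGroup {j : ℕ} (hj : 0 < p j) : (j : ℤ) ∈ offspringPeriodGroup p := by
  rcases Nat.eq_zero_or_pos j with rfl | hj1
  · exact (offspringPeriodGroup p).zero_mem
  · refine ⟨2 / (p 0 * p j), fun θ => ?_⟩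
    have h := hp.norm_offspringChar_le hj1 θ
    have hpos := mul_pos hp.zero_pos hj
    rw [zpow_natCast, div_mul_eq_mul_div, le_div_iff₀ hpos]
    linarith

theorem CriticalLaw.exists_period : ∃ g : ℕ, 1 ≤ g ∧ (∀ j, p j ≠ 0 → g ∣ j) ∧
    ∃ c : ℝ, 0 < c ∧ ∀ θ : ℝ, |θ| ≤ Real.pi / g →
      ‖offspringChar p θ‖ ≤ Real.exp (-c * θ ^ 2) := by
  obtain ⟨a, ha⟩ := Int.subgroup_cyclic (offspringPeriodGroup p)
  rw [← AddSubgroup.zmultiples_eq_closure] at ha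
  have hdvd : ∀ j, p j ≠ 0 → a.natAbs ∣ j := fun j hj => by
    have := hp.mem_offspringPeriodGroup ((hp.nonneg j).lt_of_ne' hj)
    rw [ha, Int.mem_zmultiples_iff] at this
    exact Int.natAbs_dvd_natAbs.2 this
  have hg : 1 ≤ a.natAbs := by
    obtain ⟨j, hj, hpj⟩ := hp.exists_two_le
    exact Nat.pos_of_dvd_of_pos (hdvd j hpj.ne') (by omega)
  refine ⟨a.natAbs, hg, hdvd, ?_⟩
  have hmem : ((a.natAbs : ℕ) : ℤ) ∈ offspringPeriodGroup p := by
    rw [ha, Int.mem_zmultiples_iff]; simp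
  obtain ⟨C, hC⟩ := hmem
  set g := a.natAbs
  have hg0 : (1 : ℝ) ≤ g := by exact_mod_cast hg
  have hpi := Real.pi_pos
  refine ⟨4 / Real.pi ^ 2 / max C 1, by positivity, fun θ hθ => ?_⟩
  refine le_trans ?_ (Real.add_one_le_exp _)
  have h1 := hC θ
  rw [zpow_natCast, ← Complex.exp_nat_mul] at h1
  have h2 : (g : ℂ) * (θ * Complex.I) = Complex.I * ((g * θ : ℝ) : ℂ) := by push_cast; ring
  rw [h2, Complex.norm_exp_I_mul_ofReal_sub_one, norm_mul, Real.norm_ofNat, Real.norm_eq_abs] at h1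
  have hgθ : |g * θ / 2| ≤ Real.pi / 2 := by
    rw [abs_div, abs_mul, Nat.abs_cast, abs_two]
    rw [le_div_iff₀ (by positivity)] at hθ
    linarith
  have h3 := Real.mul_abs_le_abs_sin hgθ
  have h4 : 2 / Real.pi * |θ| ≤ 2 * |Real.sin (g * θ / 2)| := by
    refine le_trans ?_ (mul_le_mul_of_nonneg_left h3 zero_le_two)
    rw [abs_div, abs_mul, Nat.abs_cast, abs_two]
    have : 2 * (2 / Real.pi * (g * |θ| / 2)) = 2 / Real.pi * (g * |θ|) := by ring
    rw [this]
    gcongr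
    exact le_mul_of_one_le_left (abs_nonneg _) hg0
  have h5 := pow_le_pow_left₀ (by positivity) h4 2
  have h6 : C * (1 - ‖offspringChar p θ‖) ≤ max C 1 * (1 - ‖offspringChar p θ‖) :=
    mul_le_mul_of_nonneg_right (le_max_left _ _)
      (sub_nonneg.2 (hp.norm_offspringChar_le_one θ))
  have h7 : 4 / Real.pi ^ 2 * θ ^ 2 ≤ max C 1 * (1 - ‖offspringChar p θ‖) := by
    refine le_trans (le_of_eq ?_) (h5.trans (h1.trans h6))
    rw [mul_pow, div_pow, sq_abs]; norm_num
  have h8 : 4 / Real.pi ^ 2 / max C 1 * θ ^ 2 ≤ 1 - ‖offspringChar p θ‖ := by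
    rw [div_mul_eq_mul_div, div_le_iff₀ (by positivity)]
    linarith
  linarith

end CharFun

theorem coeff_mk_pow_eq_zero_of_not_dvd {p : ℕ → ℝ} {g : ℕ} (hg : ∀ j, p j ≠ 0 → g ∣ j) (n : ℕ)
    {m : ℕ} (hm : ¬ g ∣ m) : PowerSeries.coeff m (PowerSeries.mk p ^ n) = 0 := by
  induction n generalizing m with
  | zero =>
    rw [pow_zero, PowerSeries.coeff_one, if_neg]
    rintro rfl
    exact hm (dvd_zero g)
  | succ n ih =>
    rw [pow_succ, PowerSeries.coeff_mul]
    refine Finset.sum_eq_zero fun kl hkl => ?_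
    rw [← Finset.HasAntidiagonal.mem_antidiagonal.1 hkl] at hm
    by_cases h1 : g ∣ kl.1
    · have h2 : ¬ g ∣ kl.2 := fun h => hm (dvd_add h1 h)
      rw [PowerSeries.coeff_mk, not_not.1 (mt (hg kl.2) h2), mul_zero]
    · rw [ih h1, zero_mul]

theorem integral_exp_mul_int_mul_I {g : ℕ} (hg : 1 ≤ g) {l : ℤ} (hl : l ≠ 0) :
    ∫ θ in -(Real.pi / g)..Real.pi / g, Complex.exp ((g * l : ℂ) * Complex.I * θ) = 0 := by
  have hg0 : (g : ℂ) ≠ 0 := by exact_mod_cast (by omega : g ≠ 0)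
  have hl0 : (l : ℂ) ≠ 0 := by exact_mod_cast hl
  rw [integral_exp_mul_complex (mul_ne_zero (mul_ne_zero hg0 hl0) Complex.I_ne_zero)]
  refine div_eq_zero_iff.2 (Or.inl (sub_eq_zero.2 ?_))
  rw [Complex.exp_eq_exp_iff_exists_int]
  refine ⟨l, ?_⟩
  push_cast
  field_simp
  ring

theorem norm_exp_I_sub_le (x : ℝ) :
    ‖Complex.exp (x * Complex.I) - 1 - x * Complex.I + x ^ 2 / 2‖ ≤ 4 * |x| ^ 3 := by
  have hx : ‖(x : ℂ) * Complex.I‖ = |x| := by simp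
  rcases le_total |x| 1 with h | h
  · have h1 := Complex.norm_exp_sub_sum_le_norm_mul_exp (x * Complex.I) 3
    rw [hx] at h1
    have h2 : Complex.exp (x * Complex.I) - ∑ m ∈ Finset.range 3, (x * Complex.I) ^ m / m.factorial =
        Complex.exp (x * Complex.I) - 1 - x * Complex.I + x ^ 2 / 2 := by
      simp only [Finset.sum_range_succ, Finset.sum_range_zero, mul_pow, Complex.I_sq]
      norm_num [Nat.factorial]
      ring
    rw [h2] at h1
    refine h1.trans ?_
    have h3 : Real.exp |x| ≤ 4 :=
      (Real.exp_le_exp.2 h).trans (by have := Real.exp_one_lt_d9; linarith)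
    nlinarith [pow_nonneg (abs_nonneg x) 3]
  · have h1 : ‖Complex.exp (x * Complex.I) - 1 - x * Complex.I + x ^ 2 / 2‖ ≤
        1 + 1 + |x| + |x| ^ 2 / 2 := by
      refine (norm_add_le _ _).trans (add_le_add ((norm_sub_le _ _).trans (add_le_add
        ((norm_sub_le _ _).trans (add_le_add ?_ ?_)) hx.le)) ?_)
      · rw [Complex.norm_exp_ofReal_mul_I]
      · simp
      · simp
    refine h1.trans ?_
    have h2 : |x| ≤ |x| ^ 3 := le_self_pow₀ h (by norm_num)
    have h3 : |x| ^ 2 ≤ |x| ^ 3 := pow_le_pow_right₀ h (by norm_num)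
    linarith

section LocalLimit
variable {p : ℕ → ℝ} (hp : CriticalLaw p)
include hp

theorem CriticalLaw.integral_offspringChar_pow {g : ℕ} (hg : 1 ≤ g) (hdvd : ∀ j, p j ≠ 0 → g ∣ j)
    (n : ℕ) {M : ℕ} (hM : g ∣ M) :
    ∫ θ in -(Real.pi / g)..Real.pi / g,
        offspringChar p θ ^ n * Complex.exp (-(M * θ * Complex.I)) =
      ((2 * (Real.pi / g) * PowerSeries.coeff M (PowerSeries.mk p ^ n) : ℝ) : ℂ) := by
  set a : ℕ → ℝ := fun m => PowerSeries.coeff m (PowerSeries.mk p ^ n) with ha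
  have hterm : ∀ (m : ℕ) (θ : ℝ), ‖(a m : ℂ) * Complex.exp (θ * Complex.I) ^ m *
      Complex.exp (-(M * θ * Complex.I))‖ = a m := by
    intro m θ
    have : -((M : ℂ) * θ * Complex.I) = ((-(M * θ) : ℝ) : ℂ) * Complex.I := by push_cast; ring
    rw [this, norm_mul, norm_mul, Complex.norm_exp_ofReal_mul_I, norm_exp_pow_eq_one, mul_one,
      mul_one, Complex.norm_real, Real.norm_of_nonneg (hp.coeff_pow_nonneg n m)]
  have hsum := intervalIntegral.hasSum_integral_of_dominated_convergence
    (μ := MeasureTheory.volume) (a := -(Real.pi / g)) (b := Real.pi / g)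
    (F := fun m θ => (a m : ℂ) * Complex.exp (θ * Complex.I) ^ m *
      Complex.exp (-(M * θ * Complex.I)))
    (f := fun θ => offspringChar p θ ^ n * Complex.exp (-(M * θ * Complex.I)))
    (fun m _ => a m)
    (fun m => Continuous.aestronglyMeasurable (by fun_prop))
    (fun m => Filter.Eventually.of_forall fun θ _ => (hterm m θ).le)
    (Filter.Eventually.of_forall fun θ _ => hp.summable_coeff_pow n)
    (by simp)
    (Filter.Eventually.of_forall fun θ _ => by
      obtain ⟨h1, h2⟩ := hp.hasSum_offspringChar_pow n θ
      rw [← h2]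
      exact h1.of_norm.hasSum.mul_right _)
  have hint : ∀ m, ∫ θ in -(Real.pi / g)..Real.pi / g, (a m : ℂ) * Complex.exp (θ * Complex.I) ^ m *
      Complex.exp (-(M * θ * Complex.I)) =
        if m = M then ((2 * (Real.pi / g) * a M : ℝ) : ℂ) else 0 := by
    intro m
    have hcomb : ∀ θ : ℝ, (a m : ℂ) * Complex.exp (θ * Complex.I) ^ m *
        Complex.exp (-(M * θ * Complex.I)) =
        a m * Complex.exp (((m : ℂ) - M) * Complex.I * θ) := by
      intro θ
      rw [← Complex.exp_nat_mul, mul_assoc, ← Complex.exp_add]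
      ring_nf
    simp_rw [hcomb]
    rw [intervalIntegral.integral_const_mul]
    split_ifs with h
    · subst h
      simp
      ring
    · by_cases hm : g ∣ m
      · obtain ⟨c, rfl⟩ := hm
        obtain ⟨d, rfl⟩ := hM
        have hl : (c : ℤ) - d ≠ 0 := by
          rw [sub_ne_zero]
          exact fun h' => h (by rw [Nat.cast_inj.1 h'])
        have := integral_exp_mul_int_mul_I hg hl
        push_cast at this ⊢
        rw [← mul_sub, this, mul_zero]
      · rw [ha]
        simp only
        rw [coeff_mk_pow_eq_zero_of_not_dvd hdvd n hm]
        simp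
  simp_rw [hint] at hsum
  exact hsum.unique (hasSum_ite_eq M _)

theorem CriticalLaw.hasSum_centered_sq : ∃ v : ℝ, 0 < v ∧
    HasSum (fun j : ℕ => ((j : ℝ) - 1) ^ 2 * p j) v := by
  have hs : Summable fun j : ℕ => ((j : ℝ) - 1) ^ 2 * p j := by
    have := (hp.sq.sub (hp.mean.summable.mul_left 2)).add hp.hasSum.summable
    refine this.congr fun j => by ring
  refine ⟨_, ?_, hs.hasSum⟩
  refine hs.tsum_pos (fun j => mul_nonneg (sq_nonneg _) (hp.nonneg j)) 0 ?_
  simpa using hp.zero_pos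

theorem CriticalLaw.exists_norm_offspringChar_sub_le : ∃ v K : ℝ, 0 < v ∧ 0 < K ∧ ∀ θ : ℝ,
    ‖offspringChar p θ * Complex.exp (-(θ * Complex.I)) - 1 + v * θ ^ 2 / 2‖ ≤ K * |θ| ^ 3 := by
  obtain ⟨v, hv, hvs⟩ := hp.hasSum_centered_sq
  have h3 : Summable fun j : ℕ => |(j : ℝ) - 1| ^ 3 * p j := by
    refine Summable.of_nonneg_of_le (fun j => mul_nonneg (by positivity) (hp.nonneg j)) (fun j => ?_)
      (hp.cube.add hp.hasSum.summable)
    rw [← add_one_mul]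
    refine mul_le_mul_of_nonneg_right ?_ (hp.nonneg j)
    rcases Nat.eq_zero_or_pos j with rfl | hj
    · simp
    · have hj1 : (1 : ℝ) ≤ j := by exact_mod_cast hj
      rw [abs_of_nonneg (by linarith)]
      have := pow_le_pow_left₀ (by linarith : (0 : ℝ) ≤ j - 1) (by linarith : (j : ℝ) - 1 ≤ j) 3
      linarith
  refine ⟨v, 4 * (∑' j : ℕ, |(j : ℝ) - 1| ^ 3 * p j) + 1, hv, by
    have : 0 ≤ ∑' j : ℕ, |(j : ℝ) - 1| ^ 3 * p j :=
      tsum_nonneg fun j => mul_nonneg (by positivity) (hp.nonneg j)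
    positivity, fun θ => ?_⟩
  have e0 : HasSum (fun j => (p j : ℂ)) 1 := by
    have := Complex.hasSum_ofReal.2 hp.hasSum
    rwa [Complex.ofReal_one] at this
  have e1 : HasSum (fun j : ℕ => ((j : ℂ) - 1) * p j) 0 := by
    have := Complex.hasSum_ofReal.2 (hp.mean.sub hp.hasSum)
    rw [sub_self, Complex.ofReal_zero] at this
    convert this using 2 with j
    push_cast
    ring
  have e2 : HasSum (fun j : ℕ => ((j : ℂ) - 1) ^ 2 * (p j : ℂ)) (v : ℂ) := by
    have := Complex.hasSum_ofReal.2 hvs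
    push_cast at this
    exact this
  have e3 : HasSum (fun j : ℕ => (p j : ℂ) * Complex.exp (θ * Complex.I) ^ j *
      Complex.exp (-(θ * Complex.I)))
      (offspringChar p θ * Complex.exp (-(θ * Complex.I))) :=
    (hp.summable_norm_term θ).of_norm.hasSum.mul_right _
  have e := ((e3.sub e0).sub (e1.mul_right (θ * Complex.I))).add (e2.mul_right ((θ : ℂ) ^ 2 / 2))
  rw [zero_mul, sub_zero, ← mul_div_assoc] at e
  rw [← e.tsum_eq]
  refine (tsum_of_norm_bounded (h3.hasSum.mul_left (4 * |θ| ^ 3)) fun j => ?_).trans ?_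
  · have hj := norm_exp_I_sub_le (((j : ℝ) - 1) * θ)
    have : (p j : ℂ) * Complex.exp (θ * Complex.I) ^ j * Complex.exp (-(θ * Complex.I)) - p j -
        ((j : ℂ) - 1) * p j * (θ * Complex.I) + ((j : ℂ) - 1) ^ 2 * p j * ((θ : ℂ) ^ 2 / 2) =
        p j * (Complex.exp ((((j : ℝ) - 1) * θ : ℝ) * Complex.I) - 1 -
          (((j : ℝ) - 1) * θ : ℝ) * Complex.I + ((((j : ℝ) - 1) * θ : ℝ) : ℂ) ^ 2 / 2) := by
      have : Complex.exp ((((j : ℝ) - 1) * θ : ℝ) * Complex.I) =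
          Complex.exp (θ * Complex.I) ^ j * Complex.exp (-(θ * Complex.I)) := by
        rw [← Complex.exp_nat_mul, ← Complex.exp_add]
        push_cast
        ring_nf
      rw [this]
      push_cast
      ring
    rw [this, norm_mul, Complex.norm_real, Real.norm_of_nonneg (hp.nonneg j)]
    refine (mul_le_mul_of_nonneg_left hj (hp.nonneg j)).trans (le_of_eq ?_)
    rw [abs_mul]
    ring
  · nlinarith [pow_nonneg (abs_nonneg θ) 3]

omit hp in
theorem norm_offspringChar_pow_mul_exp_le {g : ℕ} {c : ℝ}
    (hφ : ∀ θ : ℝ, |θ| ≤ Real.pi / g → ‖offspringChar p θ‖ ≤ Real.exp (-c * θ ^ 2)) (n : ℕ) (x : ℝ)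
    {θ : ℝ} (hθ : |θ| ≤ Real.pi / g) :
    ‖offspringChar p θ ^ n * Complex.exp (-(x * θ * Complex.I))‖ ≤ Real.exp (-(c * n) * θ ^ 2) := by
  have : -((x : ℂ) * θ * Complex.I) = ((-(x * θ) : ℝ) : ℂ) * Complex.I := by push_cast; ring
  rw [this, norm_mul, Complex.norm_exp_ofReal_mul_I, mul_one, norm_pow]
  refine (pow_le_pow_left₀ (norm_nonneg _) (hφ θ hθ) n).trans (le_of_eq ?_)
  rw [← Real.exp_nat_mul]
  ring_nf

theorem CriticalLaw.exists_coeff_pow_le : ∃ C : ℝ, 0 < C ∧ ∀ n M : ℕ, 1 ≤ n →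
    PowerSeries.coeff M (PowerSeries.mk p ^ n) ≤ C / √n := by
  obtain ⟨g, hg, hdvd, c, hc, hφ⟩ := hp.exists_period
  have hpi := Real.pi_pos
  have hg0 : (0 : ℝ) < g := by exact_mod_cast hg
  refine ⟨g / (2 * Real.pi) * √(Real.pi / c), by positivity, fun n M hn => ?_⟩
  have hn0 : (0 : ℝ) < n := by exact_mod_cast hn
  by_cases hM : g ∣ M
  swap
  · rw [coeff_mk_pow_eq_zero_of_not_dvd hdvd n hM]; positivity
  have h1 := hp.integral_offspringChar_pow hg hdvd n hM
  have hle : -(Real.pi / g) ≤ Real.pi / g := by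
    have : 0 < Real.pi / g := by positivity
    linarith
  have hcn : 0 < c * n := by positivity
  have h2 := intervalIntegral.norm_integral_le_of_norm_le hle
    (f := fun θ : ℝ => offspringChar p θ ^ n * Complex.exp (-(M * θ * Complex.I)))
    (g := fun θ => Real.exp (-(c * n) * θ ^ 2)) (μ := MeasureTheory.volume)
    (Filter.Eventually.of_forall fun θ hθ => by
      have := norm_offspringChar_pow_mul_exp_le hφ n M (θ := θ) (abs_le.2 ⟨hθ.1.le, hθ.2⟩)
      exact_mod_cast this)
    (integrable_exp_neg_mul_sq hcn).intervalIntegrable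
  rw [h1, Complex.norm_real, Real.norm_of_nonneg
    (mul_nonneg (by positivity) (hp.coeff_pow_nonneg n M)), intervalIntegral.integral_of_le hle] at h2
  have h3 := h2.trans (MeasureTheory.setIntegral_le_integral (integrable_exp_neg_mul_sq hcn)
    (Filter.Eventually.of_forall fun θ => (Real.exp_pos _).le))
  rw [integral_gaussian, ← div_div, Real.sqrt_div (by positivity)] at h3
  rw [mul_div_assoc]
  refine le_trans (le_of_eq ?_) (mul_le_mul_of_nonneg_left h3 (by positivity))
  field_simp

theorem CriticalLaw.exists_tendsto_integral {g : ℕ} (hg : 1 ≤ g) {c : ℝ} (hc : 0 < c)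
    (hφ : ∀ θ : ℝ, |θ| ≤ Real.pi / g → ‖offspringChar p θ‖ ≤ Real.exp (-c * θ ^ 2)) :
    ∃ L : ℝ, 0 < L ∧ Filter.Tendsto (fun n : ℕ => √n • ∫ θ in -(Real.pi / g)..Real.pi / g,
      offspringChar p θ ^ n * Complex.exp (-((n - 1 : ℝ) * θ * Complex.I))) Filter.atTop
        (nhds (L : ℂ)) := by
  obtain ⟨v, K, hv, hK, htaylor⟩ := hp.exists_norm_offspringChar_sub_le
  have hpi := Real.pi_pos
  have hg0 : (0 : ℝ) < g := by exact_mod_cast hg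
  have hcont := hp.continuous_offspringChar
  set F : ℕ → ℝ → ℂ := fun n θ =>
    offspringChar p θ ^ n * Complex.exp (-((n - 1 : ℝ) * θ * Complex.I)) with hF
  set S : ℕ → Set ℝ := fun n => Set.Ioc (-(√n * (Real.pi / g))) (√n * (Real.pi / g)) with hS
  refine ⟨√(Real.pi / (v / 2)), by positivity, ?_⟩
  have hlim : Filter.Tendsto (fun n : ℕ => ∫ u, (S n).indicator (fun u => F n (u / √n)) u)
      Filter.atTop (nhds (∫ u : ℝ, ((Real.exp (-(v / 2) * u ^ 2) : ℝ) : ℂ))) := by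
    refine MeasureTheory.tendsto_integral_of_dominated_convergence
      (fun u => Real.exp (-c * u ^ 2)) (fun n => ?_) (integrable_exp_neg_mul_sq hc)
      (fun n => Filter.Eventually.of_forall fun u => ?_) (Filter.Eventually.of_forall fun u => ?_)
    · refine (Continuous.aestronglyMeasurable ?_).indicator measurableSet_Ioc
      simp only [hF]
      fun_prop
    · by_cases hu : u ∈ S n
      · rw [Set.indicator_of_mem hu]
        rcases Nat.eq_zero_or_pos n with rfl | hn
        · simp [hS] at hu
        · have hn0 : (0 : ℝ) < √n := Real.sqrt_pos.2 (by exact_mod_cast hn)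
          have hle : |u / √n| ≤ Real.pi / g := by
            rw [abs_div, abs_of_pos hn0, div_le_iff₀ hn0, mul_comm, abs_le]
            exact ⟨hu.1.le, hu.2⟩
          refine (norm_offspringChar_pow_mul_exp_le hφ n (n - 1 : ℝ) hle).trans (le_of_eq ?_)
          rw [div_pow, Real.sq_sqrt (by positivity)]
          field_simp
      · rw [Set.indicator_of_notMem hu, norm_zero]
        exact (Real.exp_pos _).le
    · have hsqrt : Filter.Tendsto (fun n : ℕ => √(n : ℝ)) Filter.atTop Filter.atTop :=
        Real.tendsto_sqrt_atTop.comp tendsto_natCast_atTop_atTop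
      have hmem : ∀ᶠ n : ℕ in Filter.atTop, u ∈ S n := by
        filter_upwards [(hsqrt.atTop_mul_const (by positivity : 0 < Real.pi / g)).eventually_gt_atTop
          |u|] with n hn
        rw [hS]
        exact ⟨by linarith [neg_abs_le u], by linarith [le_abs_self u]⟩
      have hψ : Filter.Tendsto (fun n : ℕ => (n : ℂ) * (offspringChar p (u / √n) *
          Complex.exp (-((u / √n : ℝ) * Complex.I)) - 1)) Filter.atTop
          (nhds (((-(v / 2) * u ^ 2 : ℝ) : ℂ))) := by
        rw [tendsto_iff_norm_sub_tendsto_zero]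
        have hb : Filter.Tendsto (fun n : ℕ => K * |u| ^ 3 / √n) Filter.atTop (nhds 0) :=
          hsqrt.const_div_atTop _
        refine squeeze_zero' (Filter.Eventually.of_forall fun n => norm_nonneg _) ?_ hb
        filter_upwards [Filter.eventually_ge_atTop 1] with n hn
        have hn1 : (0 : ℝ) < n := by exact_mod_cast hn
        have hn0 : (0 : ℝ) < √n := Real.sqrt_pos.2 hn1
        have hsq : √(n : ℝ) ^ 2 = n := Real.sq_sqrt hn1.le
        have heq : (n : ℂ) * (offspringChar p (u / √n) *
            Complex.exp (-((u / √n : ℝ) * Complex.I)) - 1) - ((-(v / 2) * u ^ 2 : ℝ) : ℂ) =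
            n * (offspringChar p (u / √n) *
            Complex.exp (-((u / √n : ℝ) * Complex.I)) - 1 + v * ((u / √n : ℝ) : ℂ) ^ 2 / 2) := by
          have : (n : ℂ) * ((u / √n : ℝ) : ℂ) ^ 2 = (u : ℂ) ^ 2 := by
            rw [← Complex.ofReal_natCast, ← Complex.ofReal_pow, ← Complex.ofReal_mul,
              ← Complex.ofReal_pow, div_pow, hsq, mul_div_cancel₀ _ hn1.ne']
          push_cast at this ⊢
          linear_combination (-v / 2 : ℂ) * this
        rw [heq, norm_mul, Complex.norm_natCast]
        refine (mul_le_mul_of_nonneg_left (htaylor _) hn1.le).trans (le_of_eq ?_)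
        rw [abs_div, abs_of_pos hn0, div_pow]
        field_simp
        rw [hsq, mul_comm]
      have h1 := Complex.tendsto_one_add_pow_exp_of_tendsto hψ
      have h2 : Filter.Tendsto (fun n : ℕ => Complex.exp (((u / √n : ℝ) : ℂ) * Complex.I))
          Filter.atTop (nhds 1) := by
        have h3 : Filter.Tendsto (fun n : ℕ => u / √n) Filter.atTop (nhds 0) :=
          hsqrt.const_div_atTop _
        have h4 : Continuous fun x : ℝ => Complex.exp ((x : ℂ) * Complex.I) := by fun_prop
        have h5 := (h4.tendsto 0).comp h3
        simpa [Function.comp_def] using h5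
      have h3 := h1.mul h2
      rw [mul_one, ← Complex.ofReal_exp] at h3
      refine h3.congr' ?_
      filter_upwards [hmem] with n hn
      rw [Set.indicator_of_mem hn, hF]
      simp only
      rw [add_sub_cancel, mul_pow, mul_assoc, ← Complex.exp_nat_mul, ← Complex.exp_add]
      congr 2
      push_cast
      ring
  rw [integral_complex_ofReal, integral_gaussian] at hlim
  refine hlim.congr' ?_
  filter_upwards [Filter.eventually_ge_atTop 1] with n hn
  have hn0 : √(n : ℝ) ≠ 0 := (Real.sqrt_pos.2 (by exact_mod_cast hn)).ne'
  have hle : -(√n * (Real.pi / g)) ≤ √n * (Real.pi / g) := by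
    have : 0 ≤ √n * (Real.pi / g) := by positivity
    linarith
  rw [MeasureTheory.integral_indicator measurableSet_Ioc, ← intervalIntegral.integral_of_le hle,
    intervalIntegral.integral_comp_div (F n) hn0, neg_div, mul_div_cancel_left₀ _ hn0]

theorem CriticalLaw.exists_le_coeff_pow : ∃ c : ℝ, 0 < c ∧ ∀ n : ℕ, 1 ≤ n →
    0 < PowerSeries.coeff (n - 1) (PowerSeries.mk p ^ n) →
      c / √n ≤ PowerSeries.coeff (n - 1) (PowerSeries.mk p ^ n) := by
  obtain ⟨g, hg, hdvd, c, hc, hφ⟩ := hp.exists_period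
  obtain ⟨L, hL, hlim⟩ := hp.exists_tendsto_integral hg hc hφ
  have hpi := Real.pi_pos
  have hg0 : (0 : ℝ) < g := by exact_mod_cast hg
  set a : ℕ → ℝ := fun n => PowerSeries.coeff (n - 1) (PowerSeries.mk p ^ n) with ha
  have hev : ∀ᶠ n : ℕ in Filter.atTop, 0 < a n → L / 2 ≤ 2 * (Real.pi / g) * (√n * a n) := by
    filter_upwards [hlim.eventually (Metric.ball_mem_nhds _ (half_pos hL)),
      Filter.eventually_ge_atTop 1] with n hn hn1 han
    have hd : g ∣ n - 1 := by
      by_contra h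
      rw [ha] at han
      simp only at han
      rw [coeff_mk_pow_eq_zero_of_not_dvd hdvd n h] at han
      exact han.false
    have h1 := hp.integral_offspringChar_pow hg hdvd n hd
    have hcast : ((n - 1 : ℕ) : ℂ) = ((n : ℝ) - 1 : ℝ) := by
      rw [Nat.cast_sub hn1]; push_cast; ring
    rw [hcast] at h1
    rw [h1, Complex.real_smul, ← Complex.ofReal_mul, Complex.dist_of_im_eq (by simp),
      Complex.ofReal_re, Complex.ofReal_re, Real.dist_eq] at hn
    have := (abs_lt.1 hn).1
    rw [mul_left_comm] at this
    simp only [ha]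
    linarith
  obtain ⟨N, hN⟩ := Filter.eventually_atTop.1 hev
  set f : ℕ → ℝ := fun n => if 0 < √n * a n then √n * a n else 1 with hf
  have hne : (Finset.range (N + 1)).Nonempty := ⟨0, by simp⟩
  have hm : 0 < (Finset.range (N + 1)).inf' hne f := by
    rw [Finset.lt_inf'_iff]
    intro n _
    simp only [hf]
    split_ifs with h
    · exact h
    · exact one_pos
  refine ⟨min (L / 2 / (2 * (Real.pi / g))) ((Finset.range (N + 1)).inf' hne f),
    lt_min (by positivity) hm, fun n hn hpos => ?_⟩
  have hn0 : (0 : ℝ) < √n := Real.sqrt_pos.2 (by exact_mod_cast hn)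
  rw [div_le_iff₀ hn0, mul_comm _ √(n : ℝ)]
  rcases le_total N n with h | h
  · refine (min_le_left _ _).trans ?_
    rw [div_le_iff₀' (by positivity)]
    exact hN n h hpos
  · refine (min_le_right _ _).trans ((Finset.inf'_le f (Finset.mem_range.2 (Nat.lt_succ_of_le h))).trans ?_)
    simp only [hf]
    rw [if_pos (mul_pos hn0 hpos)]

theorem CriticalLaw.exists_sq_mul_mass_size_le : ∃ C : ℝ, 0 < C ∧ ∀ n : ℕ, 1 ≤ n →
    0 < (mass p fun T => T.size = n).toReal → ∀ m : ℕ, 1 ≤ m → m ≤ n →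
      (m : ℝ) ^ 2 * (mass p fun T => T.size = m).toReal ≤
        C * ((n : ℝ) ^ 2 * (mass p fun T => T.size = n).toReal) := by
  obtain ⟨C, hC, hup⟩ := hp.exists_coeff_pow_le
  obtain ⟨c, hc, hlow⟩ := hp.exists_le_coeff_pow
  refine ⟨C / c, by positivity, fun n hn hpos m hm hmn => ?_⟩
  have hn0 : (0 : ℝ) < n := by exact_mod_cast hn
  have hm0 : (0 : ℝ) < m := by exact_mod_cast hm
  have en := mul_mass_size hp.nonneg hp.hasSum n hn
  have em := mul_mass_size hp.nonneg hp.hasSum m hm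
  have h1 := hlow n hn (by rw [← en]; positivity)
  have h2 := hup m (m - 1) hm
  rw [← en] at h1
  rw [← em] at h2
  have hsm : ∀ x y : ℝ, x * (y / √x) = y * √x := fun x y => by
    rw [mul_div_left_comm, Real.div_sqrt]
  calc (m : ℝ) ^ 2 * (mass p fun T => T.size = m).toReal
      = m * (m * (mass p fun T => T.size = m).toReal) := by ring
    _ ≤ m * (C / √m) := mul_le_mul_of_nonneg_left h2 hm0.le
    _ = C * √m := hsm m C
    _ ≤ C * √n := by gcongr
    _ = C / c * (n * (c / √n)) := by rw [hsm]; field_simp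
    _ ≤ C / c * (n * (n * (mass p fun T => T.size = n).toReal)) := by gcongr
    _ = _ := by ring

theorem CriticalLaw.exists_mass_size_le : ∃ C : ℝ, 0 < C ∧ ∀ n : ℕ, 1 ≤ n →
    (mass p fun T => T.size = n).toReal ≤ C / (n * √n) := by
  obtain ⟨C, hC, hup⟩ := hp.exists_coeff_pow_le
  refine ⟨C, hC, fun n hn => ?_⟩
  have hn0 : (0 : ℝ) < n := by exact_mod_cast hn
  have h := hup n (n - 1) hn
  rw [← mul_mass_size hp.nonneg hp.hasSum n hn] at h
  rw [mul_comm, ← div_div, le_div_iff₀ hn0, mul_comm]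
  exact h

omit hp in
theorem one_div_mul_sqrt_le (r : ℕ) (hr : 1 ≤ r) :
    1 / (r * √r) ≤ 4 * (1 / √r - 1 / √(r + 1 : ℕ)) := by
  have hr0 : (1 : ℝ) ≤ r := by exact_mod_cast hr
  have ha : 0 < √(r : ℝ) := Real.sqrt_pos.2 (by linarith)
  have hb : 0 < √((r + 1 : ℕ) : ℝ) := Real.sqrt_pos.2 (by positivity)
  have ha2 : √(r : ℝ) ^ 2 = r := Real.sq_sqrt (by linarith)
  have hb2 : √((r + 1 : ℕ) : ℝ) ^ 2 = r + 1 := by rw [Real.sq_sqrt (by positivity)]; push_cast; ring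
  set a := √(r : ℝ)
  set b := √((r + 1 : ℕ) : ℝ)
  have hab : 2 * b ≤ 3 * a := abs_le_of_sq_le_sq' (by nlinarith) (by positivity) |>.2
  rw [← ha2, div_sub_div _ _ ha.ne' hb.ne', one_mul, mul_one, mul_div_assoc',
    div_le_div_iff₀ (by positivity) (by positivity)]
  have hd : (b - a) * (b + a) = 1 := by nlinarith
  have hd0 : 0 < b - a := by nlinarith
  have key : b * (b + a) ≤ 4 * a ^ 2 := by nlinarith
  have := mul_le_mul_of_nonneg_left key (mul_pos ha hd0).le
  nlinarith

theorem CriticalLaw.exists_mass_le_size_le : ∃ C : ℝ, 0 < C ∧ ∀ m : ℕ, 1 ≤ m →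
    mass p (fun T => m ≤ T.size) ≤ ENNReal.ofReal (C / √m) := by
  obtain ⟨C, hC, hq⟩ := hp.exists_mass_size_le
  refine ⟨4 * C, by positivity, fun m hm => ?_⟩
  have hsplit : mass p (fun T => m ≤ T.size) = ∑' i, mass p fun T => T.size = m + i := by
    simp only [mass_eq]
    rw [ENNReal.tsum_comm]
    refine tsum_congr fun T => ?_
    split_ifs with h
    · rw [tsum_eq_single (T.size - m) fun i hi => if_neg (by omega), if_pos (by omega)]
    · exact (ENNReal.tsum_eq_zero.2 fun i => if_neg (by omega)).symm
  rw [hsplit]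
  refine ENNReal.tsum_le_of_sum_range_le fun N => ?_
  have hle : ∀ i, mass p (fun T => T.size = m + i) ≤
      ENNReal.ofReal (4 * C * (1 / √(m + i : ℕ) - 1 / √(m + (i + 1) : ℕ))) := fun i => by
    rw [← ENNReal.ofReal_toReal (mass_ne_top hp.nonneg hp.hasSum _)]
    refine ENNReal.ofReal_le_ofReal ((hq (m + i) (by omega)).trans ?_)
    have := mul_le_mul_of_nonneg_left (one_div_mul_sqrt_le (m + i) (by omega)) hC.le
    rw [mul_one_div] at this
    refine this.trans (le_of_eq ?_)
    rw [← add_assoc]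
    ring
  refine (Finset.sum_le_sum fun i _ => hle i).trans ?_
  rw [← ENNReal.ofReal_sum_of_nonneg fun i _ => ?_]
  · refine ENNReal.ofReal_le_ofReal ?_
    rw [← Finset.mul_sum, Finset.sum_range_sub' (fun i : ℕ => 1 / √((m + i : ℕ) : ℝ)), add_zero]
    have : 0 ≤ 1 / √((m + N : ℕ) : ℝ) := by positivity
    rw [mul_sub, mul_one_div]
    linarith [mul_nonneg (by positivity : 0 ≤ 4 * C) this]
  · refine mul_nonneg (by positivity) (sub_nonneg.2 ?_)
    have : (0 : ℝ) < √(m + i : ℕ) := Real.sqrt_pos.2 (by exact_mod_cast (by omega : 0 < m + i))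
    exact one_div_le_one_div_of_le this (Real.sqrt_le_sqrt (by push_cast; linarith))

end LocalLimit

theorem rankIn_ofFn {d : ℕ} (s : Fin d → ℕ) (i : Fin d) :
    rankIn (List.ofFn s) i =
      1 + (Finset.univ.filter fun j => s i < s j ∨ (s j = s i ∧ j < i)).card := by
  have hget : ∀ j : Fin d, (List.ofFn s).getD j 0 = s j := fun j => by
    rw [List.getD_eq_getElem _ _ (by simp)]
    simp
  rw [rankIn, List.length_ofFn, ← List.toFinset_card_of_nodup (List.nodup_range.filter _),
    List.toFinset_filter, List.toFinset_range, Finset.card_filter, Finset.card_filter,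
    ← Fin.sum_univ_eq_sum_range (fun j => if decide ((List.ofFn s).getD (i : ℕ) 0 <
      (List.ofFn s).getD j 0 ∨ (List.ofFn s).getD j 0 = (List.ofFn s).getD (i : ℕ) 0 ∧ j < i) = true
      then 1 else 0)]
  simp only [hget, decide_eq_true_eq, Fin.lt_def]

theorem exists_of_le_Hstar {d : ℕ} (f : Fin d → PTree) {k ℓ : ℕ} (hk : 2 ≤ k) (hℓ : k ≤ ℓ)
    {t : ℝ} (ht : 0 < t) (h : t ≤ Hstar (.node (List.ofFn f)) ℓ) :
    ∃ i j₀ : Fin d, ∃ J : Finset (Fin d), J.card = k - 2 ∧ i ≠ j₀ ∧ i ∉ J ∧ j₀ ∉ J ∧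
      t ≤ (f i).height ∧ (∀ j ∈ J, (f i).size ≤ (f j).size) ∧
        ∑ j, (f j).size ≤ d * (f j₀).size := by
  rw [Hstar] at h
  split at h
  swap
  · exact absurd (h.trans_eq Nat.cast_zero) (not_le.2 ht)
  · rename_i i hi
    have hr := List.find?_some hi
    have hid := List.mem_of_find?_eq_some hi
    rw [List.mem_range, List.length_ofFn] at hid
    rw [decide_eq_true_eq, List.map_ofFn, rankIn_ofFn (PTree.size ∘ f) ⟨i, hid⟩] at hr
    rw [List.getD_eq_getElem _ _ (by simpa using hid)] at h
    simp only [List.getElem_ofFn, Function.comp_apply] at h hr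
    set B : Finset (Fin d) := Finset.univ.filter fun j => (f ⟨i, hid⟩).size < (f j).size ∨
      ((f j).size = (f ⟨i, hid⟩).size ∧ j < ⟨i, hid⟩) with hB
    have hle : ∀ j ∈ B, (f ⟨i, hid⟩).size ≤ (f j).size := fun j hj => by
      rw [hB, Finset.mem_filter] at hj
      omega
    have hnot : ∀ j, j ∉ B → (f j).size ≤ (f ⟨i, hid⟩).size := fun j hj => by
      rw [hB, Finset.mem_filter] at hj
      by_contra h'
      exact hj ⟨Finset.mem_univ _, Or.inl (not_le.1 h')⟩
    have hiB : (⟨i, hid⟩ : Fin d) ∉ B := by simp [hB]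
    obtain ⟨j₀, hj₀, hmax⟩ := Finset.exists_max_image B (fun j => (f j).size)
      (Finset.card_pos.1 (by omega))
    obtain ⟨J, hJ, hJc⟩ := Finset.exists_subset_card_eq (s := B.erase j₀) (n := k - 2)
      (by rw [Finset.card_erase_of_mem hj₀]; omega)
    refine ⟨⟨i, hid⟩, j₀, J, hJc, fun h' => hiB (h' ▸ hj₀),
      fun h' => hiB (Finset.mem_of_mem_erase (hJ h')),
      fun h' => Finset.notMem_erase _ _ (hJ h'), h,
      fun j hj => hle j (Finset.mem_of_mem_erase (hJ hj)), ?_⟩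
    refine (Finset.sum_le_card_nsmul _ _ (f j₀).size fun j _ => ?_).trans (by simp)
    by_cases hj : j ∈ B
    · exact hmax j hj
    · exact (hnot j hj).trans (hle j₀ hj₀)

theorem tsum_forest_Hstar_le {p : ℕ → ℝ} (hp : ∀ i, 0 ≤ p i) (h1 : HasSum p 1) {d k : ℕ}
    (hk : 2 ≤ k) {t : ℝ} (ht : 0 < t) (N : ℕ) (M : ℝ≥0∞)
    (hM : ∀ m ≤ N, N ≤ d * m → mass p (fun T => T.size = m) ≤ M)
    (Q : (Fin d → PTree) → Prop) [DecidablePred Q]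
    (hQ : ∀ f, Q f → ∑ j, (f j).size = N ∧
      ∃ ℓ, k ≤ ℓ ∧ t ≤ (Hstar (.node (List.ofFn f)) ℓ : ℝ)) :
    ∑' f : Fin d → PTree, (if Q f then ∏ j, eweight p (f j) else 0) ≤
      (d : ℝ≥0∞) ^ k * (M * ∑' T : PTree, if t ≤ (T.height : ℝ) then
        eweight p T * mass p (fun S => T.size ≤ S.size) ^ (k - 2) else 0) := by
  classical
  set B := ∑' T : PTree, if t ≤ (T.height : ℝ) then
        eweight p T * mass p (fun S => T.size ≤ S.size) ^ (k - 2) else 0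
  let X : Finset (Fin d × Fin d × Finset (Fin d)) :=
    Finset.univ ×ˢ Finset.univ ×ˢ Finset.powersetCard (k - 2) Finset.univ
  let E : Fin d × Fin d × Finset (Fin d) → (Fin d → PTree) → Prop := fun x f =>
    (∑ j, (f j).size = N ∧ N ≤ d * (f x.2.1).size) ∧ (x.1 ≠ x.2.1 ∧ x.1 ∉ x.2.2 ∧ x.2.1 ∉ x.2.2) ∧
      t ≤ ((f x.1).height : ℝ) ∧ ∀ j ∈ x.2.2, (f x.1).size ≤ (f j).size
  have hcover : ∀ f : Fin d → PTree, (if Q f then ∏ j, eweight p (f j) else 0) ≤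
      ∑ x ∈ X, if E x f then ∏ j, eweight p (f j) else 0 := by
    intro f
    split_ifs with h
    · obtain ⟨hN, ℓ, hℓ, hH⟩ := hQ f h
      obtain ⟨i, j₀, J, hJ, hij, hiJ, hjJ, hht, hsz, hsum⟩ := exists_of_le_Hstar f hk hℓ ht hH
      have hx : (i, j₀, J) ∈ X := by simp [X, Finset.mem_powersetCard, hJ]
      refine le_trans (le_of_eq ?_) (Finset.single_le_sum
        (f := fun x => if E x f then ∏ j, eweight p (f j) else 0) (fun _ _ => zero_le) hx)
      exact (if_pos ⟨⟨hN, hN ▸ hsum⟩, ⟨hij, hiJ, hjJ⟩, hht, hsz⟩).symm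
    · exact zero_le
  have hterm : ∀ x ∈ X, ∑' f : Fin d → PTree, (if E x f then ∏ j, eweight p (f j) else 0) ≤
      M * B := by
    rintro ⟨i, j₀, J⟩ hx
    have hJ : J.card = k - 2 := by simpa [X, Finset.mem_powersetCard] using hx
    by_cases hne : i ≠ j₀ ∧ i ∉ J ∧ j₀ ∉ J
    swap
    · refine (ENNReal.tsum_eq_zero.2 fun f => if_neg fun h => hne h.2.1).trans_le zero_le
    have hcard : (J.subtype (· ≠ j₀)).card = k - 2 := by
      rw [Finset.card_subtype, Finset.filter_true_of_mem, hJ]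
      rintro j hj rfl
      exact hne.2.2 hj
    have hdom := tsum_forest_dominated_le hp h1 (⟨i, hne.1⟩ : {j // j ≠ j₀}) (J.subtype (· ≠ j₀))
      (by simpa using hne.2.1) (fun T => t ≤ (T.height : ℝ))
    rw [hcard] at hdom
    refine le_trans ?_ (mul_le_mul_right hdom M)
    refine le_trans (le_of_eq ?_) (tsum_forest_remove_le p j₀ N (fun m => N ≤ d * m) M hM
      (fun g => if t ≤ ((g ⟨i, hne.1⟩).height : ℝ) ∧ ∀ j ∈ J.subtype (· ≠ j₀),
        (g ⟨i, hne.1⟩).size ≤ (g j).size then 1 else 0) (E (i, j₀, J)) fun f hf => hf.1)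
    refine tsum_congr fun f => ?_
    split_ifs with h h'
    · rw [one_mul]
    · refine absurd ⟨h.2.2.1, fun j hj => h.2.2.2 j ?_⟩ h'
      simpa using hj
    · rfl
  calc ∑' f : Fin d → PTree, (if Q f then ∏ j, eweight p (f j) else 0)
      ≤ ∑' f : Fin d → PTree, ∑ x ∈ X, if E x f then ∏ j, eweight p (f j) else 0 :=
        ENNReal.tsum_le_tsum hcover
    _ = ∑ x ∈ X, ∑' f : Fin d → PTree, (if E x f then ∏ j, eweight p (f j) else 0) :=
        Summable.tsum_finsetSum fun _ _ => ENNReal.summable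
    _ ≤ X.card • (M * B) := Finset.sum_le_card_nsmul _ _ _ hterm
    _ ≤ (d : ℝ≥0∞) ^ k * (M * B) := by
        rw [nsmul_eq_mul]
        gcongr
        have : X.card ≤ d ^ k := by
          simp only [X, Finset.card_product, Finset.card_powersetCard, Finset.card_univ,
            Fintype.card_fin]
          calc d * (d * d.choose (k - 2)) ≤ d * (d * d ^ (k - 2)) := by
                gcongr; exact Nat.choose_le_pow d (k - 2)
            _ = d ^ k := by
                rw [← pow_succ', ← pow_succ']; congr 1; omega
        exact_mod_cast this

theorem CriticalLaw.exists_mass_Hstar_le {p : ℕ → ℝ} (hp : CriticalLaw p) {k : ℕ} (hk : 2 ≤ k)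
    (hmom : Summable fun i : ℕ => (i : ℝ) ^ (k + 2) * p i) :
    ∃ C : ℝ, 0 < C ∧ ∀ n : ℕ, 1 ≤ n → 0 < (mass p fun T => T.size = n).toReal → ∀ t : ℝ, 1 ≤ t →
      mass p (fun T => T.size = n ∧ ∃ ℓ : ℕ, k ≤ ℓ ∧ t ≤ (Hstar T ℓ : ℝ)) ≤
        ENNReal.ofReal (C / t ^ (k - 1) * (mass p fun T => T.size = n).toReal) := by
  classical
  obtain ⟨C₁, hC₁, hratio⟩ := hp.exists_sq_mul_mass_size_le
  obtain ⟨C₂, hC₂, htail⟩ := hp.exists_mass_le_size_le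
  obtain ⟨C₃, hC₃, htall⟩ := hp.exists_tsum_tall_inv_sqrt_pow_le (k - 2)
  have hS0 : 0 ≤ ∑' i : ℕ, (i : ℝ) ^ (k + 2) * p i :=
    tsum_nonneg fun i => mul_nonneg (by positivity) (hp.nonneg i)
  refine ⟨4 * C₁ * C₂ ^ (k - 2) * C₃ * ((∑' i : ℕ, (i : ℝ) ^ (k + 2) * p i) + 1), by positivity,
    fun n hn hpos t ht => ?_⟩
  set q := (mass p fun T => T.size = n).toReal
  set S := ∑' i : ℕ, (i : ℝ) ^ (k + 2) * p i
  have hB : (∑' T : PTree, if t ≤ (T.height : ℝ) then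
      eweight p T * mass p (fun S => T.size ≤ S.size) ^ (k - 2) else 0) ≤
      ENNReal.ofReal (C₂ ^ (k - 2) * (C₃ / t ^ (k - 1))) := by
    rw [ENNReal.ofReal_mul (by positivity)]
    have h := htall t ht
    rw [show k - 2 + 1 = k - 1 by omega] at h
    refine le_trans ?_ (mul_le_mul_right h _)
    rw [← ENNReal.tsum_mul_left]
    refine ENNReal.tsum_le_tsum fun T => ?_
    split_ifs
    · rw [mul_left_comm, ← ENNReal.ofReal_mul (by positivity), ← mul_pow, mul_one_div,
        ENNReal.ofReal_pow (by positivity)]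
      gcongr
      exact htail _ T.size_pos
    · rw [mul_zero]
  have hM : ∀ d m : ℕ, m ≤ n - 1 → n - 1 ≤ d * m →
      mass p (fun T => T.size = m) ≤ ENNReal.ofReal (C₁ * (2 * d) ^ 2 * q) := by
    intro d m hm hd
    rcases Nat.eq_zero_or_pos m with rfl | hm0
    · refine le_trans (le_of_eq ?_) zero_le
      rw [mass_eq]
      exact ENNReal.tsum_eq_zero.2 fun T => if_neg T.size_pos.ne'
    · rw [← ENNReal.ofReal_toReal (mass_ne_top hp.nonneg hp.hasSum _)]
      refine ENNReal.ofReal_le_ofReal ?_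
      have h := hratio n hn hpos m hm0 (by omega)
      have hmp : (0 : ℝ) < m := by exact_mod_cast hm0
      have hnd : (n : ℝ) ≤ 2 * d * m := by
        have : n ≤ 2 * d * m := by rw [mul_assoc]; omega
        exact_mod_cast this
      have h2 : C₁ * ((n : ℝ) ^ 2 * q) ≤ C₁ * ((2 * d * m) ^ 2 * q) := by gcongr
      refine le_of_mul_le_mul_left ((h.trans h2).trans (le_of_eq ?_)) (pow_pos hmp 2)
      ring
  rw [mass_eq, PTree.tsum_eq_tsum_tuple]
  have hd : ∀ d : ℕ, (∑' f : Fin d → PTree,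
      if (PTree.node (List.ofFn f)).size = n ∧
        ∃ ℓ : ℕ, k ≤ ℓ ∧ t ≤ (Hstar (.node (List.ofFn f)) ℓ : ℝ)
      then eweight p (.node (List.ofFn f)) else 0) ≤
      ENNReal.ofReal (4 * C₁ * C₂ ^ (k - 2) * C₃ / t ^ (k - 1) * q * ((d : ℝ) ^ (k + 2) * p d)) := by
    intro d
    have h := tsum_forest_Hstar_le hp.nonneg hp.hasSum (d := d) hk (by linarith : 0 < t) (n - 1) _
      (hM d) (fun f => (PTree.node (List.ofFn f)).size = n ∧
        ∃ ℓ : ℕ, k ≤ ℓ ∧ t ≤ (Hstar (.node (List.ofFn f)) ℓ : ℝ))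
      fun f hf => ⟨by have := PTree.size_node_ofFn f; omega, hf.2⟩
    have hpd := hp.nonneg d
    calc _ = ∑' f : Fin d → PTree, ENNReal.ofReal (p d) *
          (if (PTree.node (List.ofFn f)).size = n ∧
            ∃ ℓ : ℕ, k ≤ ℓ ∧ t ≤ (Hstar (.node (List.ofFn f)) ℓ : ℝ)
          then ∏ j, eweight p (f j) else 0) := by
          refine tsum_congr fun f => ?_
          rw [mul_ite, mul_zero, eweight_node_ofFn hp.nonneg]
      _ ≤ ENNReal.ofReal (p d) * ((d : ℝ≥0∞) ^ k * (ENNReal.ofReal (C₁ * (2 * d) ^ 2 * q) *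
          ENNReal.ofReal (C₂ ^ (k - 2) * (C₃ / t ^ (k - 1))))) := by
          rw [ENNReal.tsum_mul_left]
          gcongr
          refine h.trans ?_
          gcongr
      _ = _ := by
          rw [← ENNReal.ofReal_natCast, ← ENNReal.ofReal_pow (by positivity),
            ← ENNReal.ofReal_mul (by positivity), ← ENNReal.ofReal_mul (by positivity),
            ← ENNReal.ofReal_mul (by positivity)]
          congr 1
          ring
  refine (ENNReal.tsum_le_tsum hd).trans ?_
  rw [← ENNReal.ofReal_tsum_of_nonneg (fun d => mul_nonneg (by positivity)
    (mul_nonneg (by positivity) (hp.nonneg d))) (hmom.mul_left _), tsum_mul_left]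
  refine ENNReal.ofReal_le_ofReal ?_
  have : 0 ≤ 4 * C₁ * C₂ ^ (k - 2) * C₃ / t ^ (k - 1) * q := by positivity
  calc _ ≤ 4 * C₁ * C₂ ^ (k - 2) * C₃ / t ^ (k - 1) * q * (S + 1) := by gcongr; linarith
    _ = _ := by ring

theorem tsum_subtype_weight {p : ℕ → ℝ} (hp : ∀ i, 0 ≤ p i) (A : PTree → Prop) :
    ∑' T : {T : PTree // A T}, weight p T.1 = (mass p A).toReal := by
  classical
  have h : mass p A = ∑' T : {T : PTree // A T}, eweight p T := by
    rw [mass_eq]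
    exact (tsum_subtype {T | A T} (eweight p)).symm ▸ tsum_congr fun T => by
      simp [Set.indicator_apply]
  rw [h, ENNReal.tsum_toReal_eq (f := fun T : {T : PTree // A T} => eweight p T)
    fun T => ENNReal.ofReal_ne_top]
  exact tsum_congr fun T => (ENNReal.toReal_ofReal (weight_nonneg hp _)).symm

theorem CriticalLaw.of_moments {p : ℕ → ℝ} (hp_nonneg : ∀ i, 0 ≤ p i) (hp_sum : ∑' i : ℕ, p i = 1)
    (hp_mean : ∑' i : ℕ, (i : ℝ) * p i = 1)
    (hp_var : 1 < ∑' i : ℕ, (i : ℝ) ^ 2 * p i) (hcube : Summable fun i : ℕ => (i : ℝ) ^ 3 * p i) :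
    CriticalLaw p := by
  have h1 : HasSum p 1 := hp_sum ▸ Summable.hasSum (by
    by_contra h
    rw [tsum_eq_zero_of_not_summable h] at hp_sum
    exact zero_ne_one hp_sum)
  have h2 : HasSum (fun i : ℕ => (i : ℝ) * p i) 1 := hp_mean ▸ Summable.hasSum (by
    by_contra h
    rw [tsum_eq_zero_of_not_summable h] at hp_mean
    exact zero_ne_one hp_mean)
  have h3 : ∃ j, 2 ≤ j ∧ 0 < p j := by
    by_contra! h
    refine hp_var.ne' ?_
    rw [← hp_mean]
    refine tsum_congr fun i => ?_
    rcases lt_or_ge i 2 with hi | hi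
    · interval_cases i <;> simp
    · rw [le_antisymm (h i hi) (hp_nonneg i), mul_zero, mul_zero]
  refine ⟨hp_nonneg, h1, h2, hcube, (hp_nonneg 0).lt_of_ne' fun h0 => ?_, h3⟩
  obtain ⟨j, hj, hpj⟩ := h3
  have hs := h2.sub h1
  rw [sub_self] at hs
  have hj2 : (2 : ℝ) ≤ j := by exact_mod_cast hj
  have hpos : 0 < ∑' i : ℕ, ((i : ℝ) * p i - p i) := by
    refine hs.summable.tsum_pos (fun i => ?_) j (by nlinarith)
    rcases Nat.eq_zero_or_pos i with rfl | hi
    · simp [h0]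
    · have hi1 : (1 : ℝ) ≤ i := by exact_mod_cast hi
      nlinarith [hp_nonneg i]
  rw [hs.tsum_eq] at hpos
  exact hpos.false

/-- tail bound for the supremum over `ℓ ≥ k` of the height of the
subtree rooted at the child of the root of rank `ℓ`. -/
theorem stmt_16 (p : ℕ → ℝ)
    (hp_nonneg : ∀ i, 0 ≤ p i)
    (hp_sum : ∑' i : ℕ, p i = 1)
    (hp_mean : ∑' i : ℕ, (i : ℝ) * p i = 1)
    (hp_sq : Summable (fun i : ℕ => (i : ℝ) ^ 2 * p i))
    (hp_var : 1 < ∑' i : ℕ, (i : ℝ) ^ 2 * p i)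
    (k : ℕ) (hk : 2 ≤ k)
    (hmom : MomentFinite p ((k : ℝ) + 2)) :
    ∃ C : ℝ, 0 < C ∧ ∀ n ∈ gwSupport p, ∀ t : ℝ, 1 ≤ t →
      condProb p n (fun T => ∃ ℓ : ℕ, k ≤ ℓ ∧ t ≤ (Hstar T ℓ : ℝ)) ≤
        C * t ^ (1 - (k : ℝ)) := by
  have hmom' : Summable fun i : ℕ => (i : ℝ) ^ (k + 2) * p i := by
    refine hmom.congr fun i => ?_
    rw [← Real.rpow_natCast]
    push_cast
    rfl
  have hcube : Summable fun i : ℕ => (i : ℝ) ^ 3 * p i := by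
    refine Summable.of_nonneg_of_le (fun i => mul_nonneg (by positivity) (hp_nonneg i))
      (fun i => mul_le_mul_of_nonneg_right ?_ (hp_nonneg i)) hmom'
    rcases Nat.eq_zero_or_pos i with rfl | hi
    · simp
    · exact pow_le_pow_right₀ (by exact_mod_cast hi) (by omega)
  have hp := CriticalLaw.of_moments hp_nonneg hp_sum hp_mean hp_var hcube
  obtain ⟨C, hC, hbound⟩ := hp.exists_mass_Hstar_le hk hmom'
  refine ⟨C, hC, fun n hn t ht => ?_⟩
  obtain ⟨hn1, hpos⟩ := hn
  rw [treeSum, tsum_subtype_weight hp_nonneg] at hpos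
  rw [condProb, treeSum, tsum_subtype_weight hp_nonneg, tsum_subtype_weight hp_nonneg,
    div_le_iff₀ hpos]
  have ht0 : 0 < t := by linarith
  have hpow : t ^ (1 - (k : ℝ)) = 1 / t ^ (k - 1) := by
    rw [← Real.rpow_natCast, Nat.cast_sub (by omega), Nat.cast_one, one_div, ← Real.rpow_neg ht0.le,
      neg_sub]
  rw [hpow, mul_one_div]
  exact ENNReal.toReal_le_of_le_ofReal (by positivity) (hbound n hn1 hpos t ht)
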